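/- There exists an absolute constant C > 0 with the following property: let {D_j} be a collection of closed unit disks in ℝ² = ℂ whose pairwise distances are at least 100, with 0 ∉ ⋃_j 3D_j. Let R > 10⁴, 0 < r ≤ R/4, N ≥ 0, and let u be a real-valued harmonic function on B(0, R) ∖ ⋃_j D_j which does not change sign on (5D_j ∖ D_j) ∩ B(0, R) for every j. If sup_{B(0, R − R/64) ∖ ⋃_j 3D_j} |u| ≥ e^{−N} · sup_{B(0, R) ∖ ⋃_j 3D_j} |u|, then sup_{B(0, r) ∖ ⋃_j 3D_j} |u| ≥ (r/R)^{C(R + N)} · sup_{B(0, R) ∖ ⋃_j 3D_j} |u|. -/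

import Mathlib

noncomputable section

open MeasureTheory Metric Filter Set
open scoped Topology ENNReal RealInnerProductSpace

/-- The Euclidean plane. -/
abbrev E2 : Type := EuclideanSpace ℝ (Fin 2)

/-- The Laplacian of a function on `ℝⁿ`, computed via iterated Fréchet derivatives in the
coordinate directions. -/
def lap {n : ℕ} (f : EuclideanSpace ℝ (Fin n) → ℝ) (x : EuclideanSpace ℝ (Fin n)) : ℝ :=
  ∑ i : Fin n, fderiv ℝ (fun y => fderiv ℝ f y (EuclideanSpace.single i 1)) x
    (EuclideanSpace.single i 1)

/-- A test function on a set `Ω`: smooth, compactly supported, with support inside `Ω`. -/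
def IsTestFun {n : ℕ} (Ω : Set (EuclideanSpace ℝ (Fin n)))
    (h : EuclideanSpace ℝ (Fin n) → ℝ) : Prop :=
  ContDiff ℝ (⊤ : ℕ∞) h ∧ HasCompactSupport h ∧ tsupport h ⊆ Ω

/-- `u` is a weak solution of `Δu + Vu = 0` on `Ω`:
`∫_Ω u Δh + ∫_Ω V u h = 0` for every test function `h` on `Ω`. -/
def IsWeakSol {n : ℕ} (Ω : Set (EuclideanSpace ℝ (Fin n)))
    (V u : EuclideanSpace ℝ (Fin n) → ℝ) : Prop :=
  ∀ h, IsTestFun Ω h →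
    (∫ x in Ω, u x * lap h x) + (∫ x in Ω, V x * u x * h x) = 0

/-- The supremum of `|u|` over a set `s`. -/
def supAbs {n : ℕ} (u : EuclideanSpace ℝ (Fin n) → ℝ) (s : Set (EuclideanSpace ℝ (Fin n))) : ℝ :=
  sSup ((fun z => |u z|) '' s)

/-- A family of closed unit balls (given by their centers) is `L`-separated if any two distinct
balls of the family are at distance at least `L` from each other. -/
def UnitBallsSeparated {n : ℕ} {ι : Type} (c : ι → EuclideanSpace ℝ (Fin n)) (L : ℝ) : Prop :=
  ∀ i j, i ≠ j → ∀ x ∈ closedBall (c i) 1, ∀ y ∈ closedBall (c j) 1, L ≤ dist x y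

/-- `u` is harmonic at every point of `s` (for `s` open this is usual harmonicity on `s`). -/
def HarmonicOnSet {n : ℕ} (u : EuclideanSpace ℝ (Fin n) → ℝ)
    (s : Set (EuclideanSpace ℝ (Fin n))) : Prop :=
  ∀ x ∈ s, ContDiffAt ℝ 2 u x ∧ lap u x = 0

/-- `u` does not change sign on `s`. -/
def NoSignChange {n : ℕ} (u : EuclideanSpace ℝ (Fin n) → ℝ)
    (s : Set (EuclideanSpace ℝ (Fin n))) : Prop :=
  (∀ x ∈ s, 0 ≤ u x) ∨ (∀ x ∈ s, u x ≤ 0)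

open InnerProductSpace

/-- Gradient estimate for nonnegative harmonic functions in the plane. -/
theorem norm_fderiv_le_of_harmonic_nonneg {u : ℂ → ℝ} {z : ℂ} {R : ℝ} (hR : 0 < R)
    (hu : HarmonicOnNhd u (ball z R)) (hpos : ∀ w ∈ ball z R, 0 ≤ u w) :
    ‖fderiv ℝ u z‖ ≤ 2 / R * u z := by
  obtain ⟨F, hF, hFu⟩ := hu.exists_analyticOnNhd_ball_re_eq
  have hz : z ∈ ball z R := mem_ball_self hR
  have hFd : DifferentiableAt ℂ F z := (hF z hz).differentiableAt
  have hgrad : ‖fderiv ℝ u z‖ ≤ ‖deriv F z‖ := by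
    have h1 : u =ᶠ[𝓝 z] fun w => (F w).re := by
      filter_upwards [isOpen_ball.mem_nhds hz] with w hw using (hFu hw).symm
    have h2 : HasFDerivAt (fun w => (F w).re)
        (Complex.reCLM.comp ((fderiv ℂ F z).restrictScalars ℝ)) z :=
      Complex.reCLM.hasFDerivAt.comp z (hFd.hasFDerivAt.restrictScalars ℝ)
    rw [h1.fderiv_eq, h2.fderiv]
    refine (ContinuousLinearMap.opNorm_comp_le _ _).trans ?_
    rw [Complex.reCLM_norm, one_mul, ContinuousLinearMap.norm_restrictScalars,
      norm_deriv_eq_norm_fderiv]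
  refine hgrad.trans (le_of_forall_pos_le_add fun ε hε => ?_)
  set δ := ε * R / 2 with hδ
  have hδ0 : 0 < δ := by positivity
  have hre : ∀ w ∈ ball z R, 0 < (F w).re + δ := fun w hw => by
    have := hpos w hw
    rw [← hFu hw] at this
    simp only at this
    linarith
  set w₀ : ℂ := F z + δ with hw₀
  have hw₀re : 0 < w₀.re := by simpa [hw₀] using hre z hz
  have hden : ∀ w ∈ ball z R, F w + δ + (starRingEnd ℂ) w₀ ≠ 0 := fun w hw h0 => by
    have := congrArg Complex.re h0
    simp only [Complex.add_re, Complex.ofReal_re, Complex.conj_re, Complex.zero_re] at this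
    have := hre w hw
    linarith
  set G : ℂ → ℂ := fun w => (F w + δ - w₀) / (F w + δ + (starRingEnd ℂ) w₀) with hG
  have hGd : DifferentiableOn ℂ G (ball z R) := by
    intro w hw
    have hFw : DifferentiableWithinAt ℂ F (ball z R) w := (hF w hw).differentiableAt.differentiableWithinAt
    exact ((hFw.add_const _).sub_const _).div ((hFw.add_const _).add_const _) (hden w hw)
  have hGz : G z = 0 := by simp [hG, hw₀]
  have hmaps : MapsTo G (ball z R) (ball (G z) 1) := by
    intro w hw
    rw [hGz, mem_ball_zero_iff, hG]
    simp only
    rw [norm_div, div_lt_one (norm_pos_iff.2 (hden w hw))]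
    have hw' := hre w hw
    have : ‖F w + δ - w₀‖ ^ 2 < ‖F w + δ + (starRingEnd ℂ) w₀‖ ^ 2 := by
      rw [← Complex.normSq_eq_norm_sq, ← Complex.normSq_eq_norm_sq, Complex.normSq_apply,
        Complex.normSq_apply]
      simp only [Complex.add_re, Complex.sub_re, Complex.ofReal_re, Complex.conj_re,
        Complex.add_im, Complex.sub_im, Complex.ofReal_im, Complex.conj_im]
      nlinarith [mul_pos hw' hw₀re]
    exact lt_of_pow_lt_pow_left₀ 2 (norm_nonneg _) this
  have hschwarz := Complex.norm_deriv_le_div_of_mapsTo_ball hGd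
    (hmaps.mono_right ball_subset_closedBall) hR
  have hderiv : deriv G z = deriv F z / (2 * w₀.re) := by
    have h1 : HasDerivAt G ((deriv F z * (F z + δ + (starRingEnd ℂ) w₀) - (F z + δ - w₀) * deriv F z)
        / (F z + δ + (starRingEnd ℂ) w₀) ^ 2) z :=
      ((hFd.hasDerivAt.add_const _).sub_const _).div ((hFd.hasDerivAt.add_const _).add_const _)
        (hden z hz)
    have h2 : F z + δ + (starRingEnd ℂ) w₀ = 2 * (w₀.re : ℂ) := by
      rw [← hw₀, Complex.add_conj]; push_cast; ring
    have h3 : (w₀.re : ℂ) ≠ 0 := by exact_mod_cast hw₀re.ne'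
    rw [h1.deriv, h2, ← hw₀]
    field_simp
    ring
  rw [hderiv, norm_div, norm_mul, Complex.norm_real, Real.norm_of_nonneg hw₀re.le] at hschwarz
  simp only [Complex.norm_ofNat] at hschwarz
  rw [div_le_div_iff₀ (by positivity) hR, one_mul] at hschwarz
  have huz : u z = (F z).re := (hFu hz).symm
  have : w₀.re = u z + δ := by simp [hw₀, huz]
  rw [this] at hschwarz
  calc ‖deriv F z‖ = ‖deriv F z‖ * R / R := by field_simp
    _ ≤ (2 * (u z + δ)) / R := by gcongr
    _ = 2 / R * u z + ε := by rw [hδ]; field_simp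

/-- Harnack's inequality along a path, from a logarithmic gradient bound. -/
theorem le_exp_mul_of_path {u : ℂ → ℝ} {γ γ' : ℝ → ℂ} {κ L : ℝ}
    (hγ : ∀ s ∈ Icc (0 : ℝ) 1, HasDerivAt γ (γ' s) s) (hL : ∀ s ∈ Icc (0 : ℝ) 1, ‖γ' s‖ ≤ L)
    (hu : ∀ s ∈ Icc (0 : ℝ) 1, DifferentiableAt ℝ u (γ s))
    (hgrad : ∀ s ∈ Icc (0 : ℝ) 1, ‖fderiv ℝ u (γ s)‖ ≤ κ * u (γ s)) :
    u (γ 0) ≤ Real.exp (κ * L) * u (γ 1) := by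
  have hd : ∀ s ∈ Icc (0 : ℝ) 1, HasDerivAt (fun s => u (γ s) * Real.exp (κ * L * s))
      (fderiv ℝ u (γ s) (γ' s) * Real.exp (κ * L * s) +
        u (γ s) * (Real.exp (κ * L * s) * (κ * L))) s := by
    intro s hs
    have h1 := (hu s hs).hasFDerivAt.comp_hasDerivAt s (hγ s hs)
    have h2 : HasDerivAt (fun s => Real.exp (κ * L * s)) (Real.exp (κ * L * s) * (κ * L)) s := by
      simpa using ((hasDerivAt_id s).const_mul (κ * L)).exp
    exact h1.mul h2
  have hmono : MonotoneOn (fun s => u (γ s) * Real.exp (κ * L * s)) (Icc 0 1) := by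
    refine monotoneOn_of_deriv_nonneg (convex_Icc 0 1)
      (fun s hs => (hd s hs).continuousAt.continuousWithinAt)
      (fun s hs => (hd s (interior_subset hs)).differentiableAt.differentiableWithinAt) ?_
    intro s hs
    have hs' := interior_subset hs
    rw [(hd s hs').deriv]
    have h1 : -(κ * u (γ s) * L) ≤ fderiv ℝ u (γ s) (γ' s) := by
      have h2 := (fderiv ℝ u (γ s)).le_opNorm (γ' s)
      have h3 : ‖fderiv ℝ u (γ s)‖ * ‖γ' s‖ ≤ κ * u (γ s) * L := by
        have := hgrad s hs'
        have := hL s hs'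
        gcongr
        exact (norm_nonneg _).trans (hgrad s hs')
      have := neg_abs_le (fderiv ℝ u (γ s) (γ' s))
      rw [Real.norm_eq_abs] at h2
      linarith
    nlinarith [Real.exp_pos (κ * L * s)]
  have := hmono (left_mem_Icc.2 zero_le_one) (right_mem_Icc.2 zero_le_one) zero_le_one
  simp only [mul_zero, Real.exp_zero, mul_one] at this
  linarith

theorem norm_fderiv_le_of_harmonic_annulus {u : ℂ → ℝ} {c z : ℂ}
    (hu : ∀ w, 1 < dist w c → dist w c < 5 → HarmonicAt u w)
    (hpos : ∀ w, 1 < dist w c → dist w c < 5 → 0 ≤ u w)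
    (h2 : 2 ≤ dist z c) (h4 : dist z c ≤ 4) : ‖fderiv ℝ u z‖ ≤ 2 * u z := by
  have key : ∀ w ∈ ball z 1, 1 < dist w c ∧ dist w c < 5 := fun w hw => by
    rw [mem_ball] at hw
    have h5 := dist_triangle w z c
    have h6 := dist_triangle z w c
    rw [dist_comm z w] at h6
    constructor <;> linarith
  simpa using norm_fderiv_le_of_harmonic_nonneg one_pos
    (fun w hw => hu w (key w hw).1 (key w hw).2) (fun w hw => hpos w (key w hw).1 (key w hw).2)

theorem harnack_annulus {u : ℂ → ℝ} {c z w : ℂ}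
    (hu : ∀ w, 1 < dist w c → dist w c < 5 → HarmonicAt u w)
    (hpos : ∀ w, 1 < dist w c → dist w c < 5 → 0 ≤ u w)
    (hz2 : 2 ≤ dist z c) (hz4 : dist z c ≤ 4) (hw2 : 2 ≤ dist w c) (hw4 : dist w c ≤ 4) :
    u z ≤ Real.exp 56 * u w := by
  have hz0 : z - c ≠ 0 := fun h => by rw [dist_eq_norm, h, norm_zero] at hz2; linarith
  have hw0 : w - c ≠ 0 := fun h => by rw [dist_eq_norm, h, norm_zero] at hw2; linarith
  set A := Complex.log (z - c) with hA
  set B := Complex.log (w - c) with hB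
  rw [dist_eq_norm] at hz2 hz4 hw2 hw4
  have hAre : A.re = Real.log ‖z - c‖ := Complex.log_re _
  have hBre : B.re = Real.log ‖w - c‖ := Complex.log_re _
  have hA2 : Real.log 2 ≤ A.re := hAre ▸ Real.log_le_log (by norm_num) hz2
  have hA4 : A.re ≤ Real.log 4 := hAre ▸ Real.log_le_log (by linarith) hz4
  have hB2 : Real.log 2 ≤ B.re := hBre ▸ Real.log_le_log (by norm_num) hw2
  have hB4 : B.re ≤ Real.log 4 := hBre ▸ Real.log_le_log (by linarith) hw4
  have hlog4 : Real.log 4 = 2 * Real.log 2 := by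
    rw [show (4 : ℝ) = 2 ^ 2 by norm_num, Real.log_pow]; norm_num
  have hAB : ‖B - A‖ ≤ 7 := by
    refine (Complex.norm_le_abs_re_add_abs_im _).trans ?_
    have h1 : |(B - A).re| ≤ Real.log 2 := by
      rw [Complex.sub_re, abs_le]; constructor <;> linarith
    have h2 : |(B - A).im| ≤ 2 * Real.pi := by
      have := Complex.neg_pi_lt_log_im (z - c)
      have := Complex.log_im_le_pi (z - c)
      have := Complex.neg_pi_lt_log_im (w - c)
      have := Complex.log_im_le_pi (w - c)
      rw [Complex.sub_im, abs_le]; constructor <;> linarith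
    have := Real.log_two_lt_d9
    have := Real.pi_lt_d2
    linarith
  set γ : ℝ → ℂ := fun s => c + Complex.exp (A + s * (B - A)) with hγ
  have hnorm : ∀ s ∈ Icc (0 : ℝ) 1, 2 ≤ dist (γ s) c ∧ dist (γ s) c ≤ 4 := fun s hs => by
    have h1 : dist (γ s) c = Real.exp ((1 - s) * A.re + s * B.re) := by
      rw [dist_eq_norm, hγ]
      simp only [add_sub_cancel_left, Complex.norm_exp]
      simp only [Complex.add_re, Complex.mul_re, Complex.ofReal_re, Complex.ofReal_im,
        Complex.sub_re, zero_mul, sub_zero]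
      ring_nf
    rw [h1, ← Real.log_le_iff_le_exp (by norm_num), ← Real.le_log_iff_exp_le (by norm_num)]
    obtain ⟨hs0, hs1⟩ := hs
    constructor <;> nlinarith
  have hder : ∀ s ∈ Icc (0 : ℝ) 1, HasDerivAt γ (Complex.exp (A + s * (B - A)) * (B - A)) s :=
    fun s _ => by
      have h1 : HasDerivAt (fun s : ℝ => A + s * (B - A)) (B - A) s := by
        simpa using ((Complex.ofRealCLM.hasDerivAt (x := s)).mul_const (B - A)).const_add A
      exact h1.cexp.const_add c
  have h := le_exp_mul_of_path (u := u) (κ := 2) (L := 28) hder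
    (fun s hs => by
      have := (hnorm s hs).2
      rw [dist_eq_norm, hγ] at this
      simp only [add_sub_cancel_left] at this
      rw [norm_mul]
      calc _ ≤ (4 : ℝ) * 7 := by gcongr
        _ = 28 := by norm_num)
    (fun s hs => by
      have := hnorm s hs
      exact (hu _ (by linarith) (by linarith)).1.differentiableAt (by norm_num))
    (fun s hs => norm_fderiv_le_of_harmonic_annulus hu hpos (hnorm s hs).1 (hnorm s hs).2)
  have e0 : γ 0 = z := by simp [hγ, hA, Complex.exp_log hz0]
  have e1 : γ 1 = w := by simp [hγ, hB, Complex.exp_log hw0]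
  rw [e0, e1] at h
  norm_num at h
  exact h

/-- A function on the plane, harmonic in the disk of radius `R` outside of separated unit disks
that stay away from the origin, and of constant sign around each of these disks. -/
structure PerforatedHarmonic {ι : Type} (c : ι → ℂ) (R : ℝ) (v : ℂ → ℝ) : Prop where
  sep : ∀ i j, i ≠ j → 100 ≤ dist (c i) (c j)
  three_lt : ∀ i, 3 < ‖c i‖
  harm : ∀ z, ‖z‖ < R → (∀ i, 1 < dist z (c i)) → HarmonicAt v z
  sign : ∀ i, (∀ z, 1 < dist z (c i) → dist z (c i) ≤ 5 → ‖z‖ < R → 0 ≤ v z) ∨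
    (∀ z, 1 < dist z (c i) → dist z (c i) ≤ 5 → ‖z‖ < R → v z ≤ 0)

/-- `|v| ≤ m` on the disk of radius `ρ` outside of the disks of radius `3`. -/
def BoundedOff {ι : Type} (c : ι → ℂ) (v : ℂ → ℝ) (ρ m : ℝ) : Prop :=
  ∀ z, ‖z‖ < ρ → (∀ i, 3 < dist z (c i)) → |v z| ≤ m

theorem le_dist_of_dist_le {ι : Type} {c : ι → ℂ} (hsep : ∀ i j, i ≠ j → 100 ≤ dist (c i) (c j))
    {i j : ι} (hij : j ≠ i) {z : ℂ} (hz : dist z (c i) ≤ 10) : 90 ≤ dist z (c j) := by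
  have h1 := hsep j i hij
  have h2 := dist_triangle (c j) z (c i)
  rw [dist_comm (c j) z] at h2
  linarith

namespace PerforatedHarmonic

variable {ι : Type} {c : ι → ℂ} {R : ℝ} {v : ℂ → ℝ}

theorem annulus (hv : PerforatedHarmonic c R v) {i : ι} (hi : ‖c i‖ + 5 ≤ R) :
    ∃ σ : ℝ, |σ| = 1 ∧ (∀ w, 1 < dist w (c i) → dist w (c i) < 5 →
        HarmonicAt (fun z => σ * v z) w) ∧
      (∀ w, 1 < dist w (c i) → dist w (c i) < 5 → 0 ≤ σ * v w) := by
  have hR : ∀ w, dist w (c i) < 5 → ‖w‖ < R := fun w hw => by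
    have := norm_sub_norm_le w (c i)
    rw [dist_eq_norm] at hw
    linarith
  have hh : ∀ w, 1 < dist w (c i) → dist w (c i) < 5 → HarmonicAt v w := fun w h1 h5 => by
    refine hv.harm w (hR w h5) fun j => ?_
    rcases eq_or_ne j i with rfl | hj
    · exact h1
    · linarith [le_dist_of_dist_le hv.sep hj (z := w) (by linarith)]
  rcases hv.sign i with h | h
  · refine ⟨1, by simp, fun w h1 h5 => by simpa using hh w h1 h5, fun w h1 h5 => ?_⟩
    simpa using h w h1 h5.le (hR w h5)
  · refine ⟨-1, by simp, fun w h1 h5 => ?_, fun w h1 h5 => ?_⟩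
    · have := (hh w h1 h5).neg
      simp only [neg_mul, one_mul]
      exact this
    · simpa using h w h1 h5.le (hR w h5)

theorem abs_le_exp_mul (hv : PerforatedHarmonic c R v) {i : ι} (hi : ‖c i‖ + 5 ≤ R) {z w : ℂ}
    (hz2 : 2 ≤ dist z (c i)) (hz4 : dist z (c i) ≤ 4) (hw2 : 2 ≤ dist w (c i))
    (hw4 : dist w (c i) ≤ 4) : |v z| ≤ Real.exp 56 * |v w| := by
  obtain ⟨σ, hσ, h1, h2⟩ := hv.annulus hi
  have h := harnack_annulus h1 h2 hz2 hz4 hw2 hw4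
  have e : ∀ y, |v y| = |σ * v y| := fun y => by rw [abs_mul, hσ, one_mul]
  rw [e z, e w, abs_of_nonneg (h2 z (by linarith) (by linarith)),
    abs_of_nonneg (h2 w (by linarith) (by linarith))]
  exact h

theorem norm_fderiv_le_abs (hv : PerforatedHarmonic c R v) {i : ι} (hi : ‖c i‖ + 5 ≤ R) {z : ℂ}
    (hz2 : 2 ≤ dist z (c i)) (hz4 : dist z (c i) ≤ 4) : ‖fderiv ℝ v z‖ ≤ 2 * |v z| := by
  obtain ⟨σ, hσ, h1, h2⟩ := hv.annulus hi
  have h := norm_fderiv_le_of_harmonic_annulus h1 h2 hz2 hz4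
  have hz := h2 z (by linarith) (by linarith)
  rw [show (fun z => σ * v z) = σ • v from rfl, fderiv_const_smul_field, Pi.smul_apply, norm_smul, Real.norm_eq_abs, hσ, one_mul] at h
  rwa [← abs_of_nonneg hz, abs_mul, hσ, one_mul] at h

theorem abs_le_of_boundedOff (hv : PerforatedHarmonic c R v) {ρ m : ℝ} (hρ : ρ ≤ R)
    (hm : BoundedOff c v ρ m) {z : ℂ} (hz : ‖z‖ < ρ - 20) (hzc : ∀ i, 2 ≤ dist z (c i)) :
    |v z| ≤ Real.exp 56 * m := by
  by_cases h : ∀ i, 3 < dist z (c i)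
  · have h1 := hm z (by linarith) h
    have h2 : 1 ≤ Real.exp 56 := Real.one_le_exp (by norm_num)
    have := abs_nonneg (v z)
    nlinarith
  · push Not at h
    obtain ⟨i, hi⟩ := h
    set w : ℂ := c i + (7 / 2 : ℝ) with hw
    have hwd : dist w (c i) = 7 / 2 := by
      rw [hw, dist_eq_norm, add_sub_cancel_left, Complex.norm_real]; norm_num
    have hci : ‖c i‖ ≤ ‖z‖ + 3 := by
      have := norm_sub_norm_le (c i) z
      rw [← dist_eq_norm, dist_comm] at this
      linarith
    have hwn : ‖w‖ < ρ := by
      have := norm_sub_norm_le w (c i)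
      rw [← dist_eq_norm] at this
      linarith
    refine (hv.abs_le_exp_mul (i := i) (w := w) (by linarith) (hzc i) (by linarith)
      (by linarith) (by linarith)).trans ?_
    gcongr
    refine hm w hwn fun j => ?_
    rcases eq_or_ne j i with rfl | hj
    · linarith
    · linarith [le_dist_of_dist_le hv.sep hj (z := w) (by linarith)]

/-- Gradient bound from a bound of the function on a disk. -/
theorem norm_fderiv_le_of_abs_le {z : ℂ} {δ M : ℝ} (hδ : 0 < δ)
    (hh : ∀ w ∈ ball z δ, HarmonicAt v w) (hM : ∀ w ∈ ball z δ, |v w| ≤ M) :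
    ‖fderiv ℝ v z‖ ≤ 4 / δ * M := by
  have h := norm_fderiv_le_of_harmonic_nonneg (u := fun w => M + v w) hδ
    (fun w hw => (harmonicAt_const M).add (hh w hw))
    (fun w hw => by linarith [neg_abs_le (v w), hM w hw])
  rw [fderiv_const_add] at h
  have h1 := hM z (mem_ball_self hδ)
  have h2 := le_abs_self (v z)
  calc _ ≤ _ := h
    _ ≤ 2 / δ * (M + M) := by gcongr; linarith
    _ = _ := by ring

theorem norm_fderiv_le_of_boundedOff (hv : PerforatedHarmonic c R v) {ρ m : ℝ} (hρ : ρ ≤ R)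
    (hm : BoundedOff c v ρ m) {z : ℂ} (hz : ‖z‖ < ρ - 21) (hzc : ∀ i, 5 / 2 ≤ dist z (c i)) :
    ‖fderiv ℝ v z‖ ≤ 8 * (Real.exp 56 * m) := by
  have key : ∀ w ∈ ball z (1 / 2), ‖w‖ < ρ - 20 ∧ ∀ i, 2 ≤ dist w (c i) := fun w hw => by
    rw [mem_ball] at hw
    constructor
    · have := norm_sub_norm_le w z
      rw [← dist_eq_norm] at this
      linarith
    · intro i
      have := dist_triangle z w (c i)
      rw [dist_comm z w] at this
      linarith [hzc i]
  have := norm_fderiv_le_of_abs_le (v := v) (z := z) (δ := 1 / 2) (M := Real.exp 56 * m)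
    (by norm_num)
    (fun w hw => hv.harm w (by linarith [(key w hw).1]) fun i => by linarith [(key w hw).2 i])
    (fun w hw => hv.abs_le_of_boundedOff hρ hm (key w hw).1 (key w hw).2)
  norm_num at this ⊢
  exact this

theorem abs_le_of_boundedOff_small (hv : PerforatedHarmonic c R v) {r m : ℝ} (hR : 100 < R)
    (hr : 0 < r) (hr60 : r < 60) (hm : BoundedOff c v r m) {z : ℂ}
    (hz : ‖z‖ < 2 * (r / 1000)) : |v z| ≤ Real.exp 56 * m := by
  by_cases h : ∀ i, 3 < dist z (c i)
  · have h1 := hm z (by linarith) h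
    have h2 : 1 ≤ Real.exp 56 := Real.one_le_exp (by norm_num)
    have := abs_nonneg (v z)
    nlinarith
  · push Not at h
    obtain ⟨i, hi⟩ := h
    have hci3 := hv.three_lt i
    have hci : ‖c i‖ ≤ ‖z‖ + 3 := by
      have := norm_sub_norm_le (c i) z
      rw [← dist_eq_norm, dist_comm] at this
      linarith
    have hzi : ‖c i‖ - ‖z‖ ≤ dist z (c i) := by
      have := norm_sub_norm_le (c i) z
      rwa [← dist_eq_norm, dist_comm] at this
    set e : ℂ := c i / ‖c i‖ with he
    have hc0 : ‖c i‖ ≠ 0 := by linarith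
    have hen : ‖e‖ = 1 := by
      rw [he, norm_div, Complex.norm_real, norm_norm, div_self hc0]
    set δ := 4 * (r / 1000) with hδ
    set w : ℂ := z - δ * e with hw
    have hδe : ‖(δ : ℂ) * e‖ = δ := by
      rw [norm_mul, hen, mul_one, Complex.norm_real, Real.norm_of_nonneg (by positivity)]
    have hwn : ‖w‖ ≤ ‖z‖ + δ := by
      rw [← hδe]; exact norm_sub_le _ _
    have hce : c i = ‖c i‖ * e := by
      have : (‖c i‖ : ℂ) ≠ 0 := by exact_mod_cast hc0
      rw [he]; field_simp
    have hwd : ‖c i‖ + δ - ‖z‖ ≤ dist w (c i) := by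
      have h1 : ‖(c i + δ * e) - z‖ = dist w (c i) := by
        rw [dist_eq_norm, hw, ← norm_neg]; ring_nf
      have h2 : ‖c i + δ * e‖ = ‖c i‖ + δ := by
        conv_lhs => rw [hce]
        rw [← add_mul, norm_mul, hen, mul_one, ← Complex.ofReal_add, Complex.norm_real,
          Real.norm_of_nonneg (by positivity)]
      rw [← h1, ← h2]
      exact norm_sub_norm_le _ _
    have hwd' : dist w (c i) ≤ 4 := by
      have h1 := dist_triangle w z (c i)
      have h2 : dist w z = δ := by
        rw [dist_eq_norm, hw, sub_sub_cancel_left, norm_neg, hδe]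
      linarith
    refine (hv.abs_le_exp_mul (i := i) (w := w) (by linarith) (by linarith) (by linarith)
      (by linarith) hwd').trans ?_
    gcongr
    refine hm w (by linarith) fun j => ?_
    rcases eq_or_ne j i with rfl | hj
    · linarith
    · linarith [le_dist_of_dist_le hv.sep hj (z := w) (by linarith)]

/-- Bounds of `v` and its gradient near the origin. -/
theorem inner_bounds (hv : PerforatedHarmonic c R v) {r m : ℝ} (hR : 100 < R)
    (hr : 0 < r) (hrR : r ≤ R / 4) (hm : BoundedOff c v r m) {z : ℂ}
    (hz : ‖z‖ ≤ if r < 60 then r / 1000 else r / 1000 + 6) (hzc : ∀ i, 5 / 2 ≤ dist z (c i)) :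
    |v z| ≤ Real.exp 56 * m ∧
      ‖fderiv ℝ v z‖ ≤ 8 * (1 + 1 / (r / 1000)) * (Real.exp 56 * m) := by
  have hr' : 0 < 1 / (r / 1000) := by positivity
  split_ifs at hz with h60
  · have hz1 := hv.abs_le_of_boundedOff_small hR hr h60 hm (z := z) (by linarith)
    refine ⟨hz1, ?_⟩
    have key : ∀ w ∈ ball z (r / 1000), ‖w‖ < 2 * (r / 1000) := fun w hw => by
      rw [mem_ball, dist_eq_norm] at hw
      linarith [norm_sub_norm_le w z]
    have h := norm_fderiv_le_of_abs_le (v := v) (z := z) (δ := r / 1000) (M := Real.exp 56 * m)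
      (by positivity)
      (fun w hw => hv.harm w (by linarith [key w hw]) fun i => by
        have h1 := norm_sub_norm_le (c i) w
        rw [← dist_eq_norm, dist_comm] at h1
        linarith [key w hw, hv.three_lt i])
      (fun w hw => hv.abs_le_of_boundedOff_small hR hr h60 hm (key w hw))
    refine h.trans ?_
    have h0 : 0 ≤ Real.exp 56 * m := (abs_nonneg _).trans hz1
    gcongr
    rw [div_eq_mul_one_div]
    linarith
  · push Not at h60
    have hz1 := hv.abs_le_of_boundedOff (ρ := r) (by linarith) hm (z := z) (by linarith)
      (fun i => by linarith [hzc i])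
    refine ⟨hz1, (hv.norm_fderiv_le_of_boundedOff (ρ := r) (by linarith) hm (by linarith)
      hzc).trans ?_⟩
    have h0 : 0 ≤ Real.exp 56 * m := (abs_nonneg _).trans hz1
    gcongr
    linarith

end PerforatedHarmonic

/-- Derivative of a function on the plane in the real direction. -/
def partialRe (f : ℂ → ℝ) (z : ℂ) : ℝ := fderiv ℝ f z 1

/-- Derivative of a function on the plane in the imaginary direction. -/
def partialIm (f : ℂ → ℝ) (z : ℂ) : ℝ := fderiv ℝ f z Complex.I

/-- The Laplacian on the plane. -/
def planeLaplacian (f : ℂ → ℝ) (z : ℂ) : ℝ :=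
  partialRe (partialRe f) z + partialIm (partialIm f) z

theorem ContDiffAt.partialRe {f : ℂ → ℝ} {z : ℂ} {m n : WithTop ℕ∞} (hf : ContDiffAt ℝ n f z)
    (hmn : m + 1 ≤ n) : ContDiffAt ℝ m (partialRe f) z :=
  (hf.fderiv_right hmn).clm_apply contDiffAt_const

theorem ContDiffAt.partialIm {f : ℂ → ℝ} {z : ℂ} {m n : WithTop ℕ∞} (hf : ContDiffAt ℝ n f z)
    (hmn : m + 1 ≤ n) : ContDiffAt ℝ m (partialIm f) z :=
  (hf.fderiv_right hmn).clm_apply contDiffAt_const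

theorem Filter.EventuallyEq.partialRe {f g : ℂ → ℝ} {z : ℂ} (h : f =ᶠ[𝓝 z] g) :
    partialRe f =ᶠ[𝓝 z] partialRe g :=
  (h.fderiv (𝕜 := ℝ)).mono fun w hw => by
    show fderiv ℝ f w 1 = fderiv ℝ g w 1
    rw [hw]

theorem Filter.EventuallyEq.partialIm {f g : ℂ → ℝ} {z : ℂ} (h : f =ᶠ[𝓝 z] g) :
    partialIm f =ᶠ[𝓝 z] partialIm g :=
  (h.fderiv (𝕜 := ℝ)).mono fun w hw => by
    show fderiv ℝ f w Complex.I = fderiv ℝ g w Complex.I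
    rw [hw]

theorem Filter.EventuallyEq.planeLaplacian {f g : ℂ → ℝ} {z : ℂ} (h : f =ᶠ[𝓝 z] g) :
    planeLaplacian f =ᶠ[𝓝 z] planeLaplacian g := by
  filter_upwards [h.partialRe.partialRe, h.partialIm.partialIm] with w h1 h2
  simp only [_root_.planeLaplacian, h1, h2]

@[simp] theorem partialRe_const (a : ℝ) : partialRe (fun _ => a) = fun _ => 0 := by
  funext z; simp [partialRe]

@[simp] theorem partialIm_const (a : ℝ) : partialIm (fun _ => a) = fun _ => 0 := by
  funext z; simp [partialIm]

theorem partialRe_partialIm_comm {f : ℂ → ℝ} {z : ℂ} (hf : ContDiffAt ℝ 2 f z) :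
    partialRe (partialIm f) z = partialIm (partialRe f) z := by
  have hd : DifferentiableAt ℝ (fderiv ℝ f) z :=
    (hf.fderiv_right (m := 1) (by norm_num)).differentiableAt (by norm_num)
  have h : ∀ a b : ℂ, fderiv ℝ (fun w => fderiv ℝ f w a) z b = fderiv ℝ (fderiv ℝ f) z b a := by
    intro a b
    rw [fderiv_clm_apply hd (differentiableAt_const a)]
    simp
  have hs : IsSymmSndFDerivAt ℝ f z := hf.isSymmSndFDerivAt (by simp)
  have h1 := h Complex.I 1
  have h2 := h 1 Complex.I
  have h3 := hs 1 Complex.I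
  simp only [partialRe, partialIm]
  exact h1.trans (h3.trans h2.symm)

/-- A function that is regular near the support of `h` and vanishes off this support. -/
theorem contDiff_of_eq_zero_off_tsupport {h f : ℂ → ℝ} {Ω : Set ℂ} {n : WithTop ℕ∞}
    (hsub : tsupport h ⊆ Ω) (hf : ∀ z ∈ Ω, ContDiffAt ℝ n f z) (h0 : ∀ z ∉ tsupport h, f z = 0) :
    ContDiff ℝ n f := by
  refine contDiff_iff_contDiffAt.2 fun z => ?_
  by_cases hz : z ∈ tsupport h
  · exact hf z (hsub hz)
  · have : f =ᶠ[𝓝 z] fun _ => 0 := by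
      filter_upwards [(isClosed_tsupport h).isOpen_compl.mem_nhds hz] with w hw using h0 w hw
    exact contDiffAt_const.congr_of_eventuallyEq this

theorem integral_fderiv_apply_eq_zero {V : ℂ → ℝ} (hV : ContDiff ℝ 1 V) (hc : HasCompactSupport V)
    (e : ℂ) : Integrable (fun z => fderiv ℝ V z e) ∧ ∫ z, fderiv ℝ V z e = 0 := by
  have hi : Integrable (fun z => fderiv ℝ V z e) :=
    ((hV.continuous_fderiv (by norm_num)).clm_apply continuous_const).integrable_of_hasCompactSupport
      ((hc.fderiv (𝕜 := ℝ)).comp_left (g := fun L : ℂ →L[ℝ] ℝ => L e) (by simp))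
  refine ⟨hi, ?_⟩
  have := integral_mul_fderiv_eq_neg_fderiv_mul_of_integrable (μ := volume) (f := V)
    (g := fun _ => (1 : ℝ)) (v := e) (by simpa using hi) (by simp)
    (by simpa using hV.continuous.integrable_of_hasCompactSupport hc)
    (fun x _ => hV.differentiable (by norm_num) x) (fun x _ => differentiableAt_const _)
  simpa using this

theorem carleman_pointwise {h φ a V W : ℂ → ℝ} {t R : ℝ} {z : ℂ} (hh : ContDiffAt ℝ 3 h z)
    (hφ : ContDiffAt ℝ 2 φ z) (ha : ContDiffAt ℝ 1 a z) (ha0 : 0 ≤ a z)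
    (hlap : a z ≤ planeLaplacian φ z)
    (hrad : z.re * partialRe a z + z.im * partialIm a z +
      (z.re * partialRe φ z + z.im * partialIm φ z + 2 + t) * a z ≤ 0)
    (hzR : ‖z‖ ≤ R) (hR : 0 < R) (ht : 0 < t)
    (hV : V = fun z => Real.exp (φ z) * (2 * (partialRe h z * partialIm (partialIm h) z -
        partialIm h z * partialIm (partialRe h) z) -
        (partialRe h z ^ 2 + partialIm h z ^ 2) * partialRe φ z +
        t / (2 * R ^ 2) * h z ^ 2 * a z * z.re))
    (hW : W = fun z => Real.exp (φ z) * (2 * (partialIm h z * partialRe (partialRe h) z -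
        partialRe h z * partialRe (partialIm h) z) -
        (partialRe h z ^ 2 + partialIm h z ^ 2) * partialIm φ z +
        t / (2 * R ^ 2) * h z ^ 2 * a z * z.im)) :
    (t / (2 * R)) ^ 2 * (h z ^ 2 * (a z * Real.exp (φ z))) + (partialRe V z + partialIm W z) ≤
      planeLaplacian h z ^ 2 * Real.exp (φ z) := by
  set lam := t / (2 * R ^ 2) with hlam
  have hd : ∀ {f : ℂ → ℝ}, ContDiffAt ℝ 1 f z → HasFDerivAt f (fderiv ℝ f z) z :=
    fun hf => (hf.differentiableAt (by norm_num)).hasFDerivAt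
  have hh2 : ContDiffAt ℝ 2 h z := hh.of_le (by norm_num)
  have hp2 : ContDiffAt ℝ 2 (partialRe h) z := hh.partialRe (by norm_num)
  have hq2 : ContDiffAt ℝ 2 (partialIm h) z := hh.partialIm (by norm_num)
  have hp := hd (hp2.of_le (by norm_num))
  have hq := hd (hq2.of_le (by norm_num))
  have hpx := hd (hp2.partialRe (m := 1) (by norm_num))
  have hpy := hd (hp2.partialIm (m := 1) (by norm_num))
  have hqx := hd (hq2.partialRe (m := 1) (by norm_num))
  have hqy := hd (hq2.partialIm (m := 1) (by norm_num))
  have hφx := hd (hφ.partialRe (m := 1) (by norm_num))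
  have hφy := hd (hφ.partialIm (m := 1) (by norm_num))
  have hφ1 := hd (hφ.of_le (by norm_num))
  have ha1 := hd ha
  have hh1 := hd (hh.of_le (by norm_num))
  have hre : HasFDerivAt (fun z : ℂ => z.re) Complex.reCLM z := Complex.reCLM.hasFDerivAt
  have him : HasFDerivAt (fun z : ℂ => z.im) Complex.imCLM z := Complex.imCLM.hasFDerivAt
  have hVd := hφ1.exp.mul (((((hp.mul hqy).sub (hq.mul hpy)).const_mul 2).sub
    (((hp.pow 2).add (hq.pow 2)).mul hφx)).add ((((hh1.pow 2).const_mul lam).mul ha1).mul hre))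
  have hWd := hφ1.exp.mul (((((hq.mul hpx).sub (hp.mul hqx)).const_mul 2).sub
    (((hp.pow 2).add (hq.pow 2)).mul hφy)).add ((((hh1.pow 2).const_mul lam).mul ha1).mul him))
  have hVd' := hVd.fderiv
  have hWd' := hWd.fderiv
  have eV : partialRe V z = Real.exp (φ z) * partialRe φ z *
      (2 * (partialRe h z * partialIm (partialIm h) z - partialIm h z * partialIm (partialRe h) z) -
        (partialRe h z ^ 2 + partialIm h z ^ 2) * partialRe φ z + lam * h z ^ 2 * a z * z.re) +
      Real.exp (φ z) * (2 * (partialRe (partialRe h) z * partialIm (partialIm h) z +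
          partialRe h z * partialRe (partialIm (partialIm h)) z -
          partialRe (partialIm h) z * partialIm (partialRe h) z -
          partialIm h z * partialRe (partialIm (partialRe h)) z) -
        (2 * partialRe h z * partialRe (partialRe h) z +
          2 * partialIm h z * partialRe (partialIm h) z) * partialRe φ z -
        (partialRe h z ^ 2 + partialIm h z ^ 2) * partialRe (partialRe φ) z +
        lam * (2 * h z * partialRe h z * a z * z.re + h z ^ 2 * partialRe a z * z.re +
          h z ^ 2 * a z)) := by
    rw [hV]
    refine (congrArg (fun L : ℂ →L[ℝ] ℝ => L 1) hVd').trans ?_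
    simp [partialRe]
    ring
  have eW : partialIm W z = Real.exp (φ z) * partialIm φ z *
      (2 * (partialIm h z * partialRe (partialRe h) z - partialRe h z * partialRe (partialIm h) z) -
        (partialRe h z ^ 2 + partialIm h z ^ 2) * partialIm φ z + lam * h z ^ 2 * a z * z.im) +
      Real.exp (φ z) * (2 * (partialIm (partialIm h) z * partialRe (partialRe h) z +
          partialIm h z * partialIm (partialRe (partialRe h)) z -
          partialIm (partialRe h) z * partialRe (partialIm h) z -
          partialRe h z * partialIm (partialRe (partialIm h)) z) -
        (2 * partialRe h z * partialIm (partialRe h) z +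
          2 * partialIm h z * partialIm (partialIm h) z) * partialIm φ z -
        (partialRe h z ^ 2 + partialIm h z ^ 2) * partialIm (partialIm φ) z +
        lam * (2 * h z * partialIm h z * a z * z.im + h z ^ 2 * partialIm a z * z.im +
          h z ^ 2 * a z)) := by
    rw [hW]
    refine (congrArg (fun L : ℂ →L[ℝ] ℝ => L Complex.I) hWd').trans ?_
    simp [partialIm]
    ring
  have c1 := partialRe_partialIm_comm hh2
  have c2 := partialRe_partialIm_comm hp2
  have c3 := partialRe_partialIm_comm hq2
  have c4 : partialRe (partialIm h) =ᶠ[𝓝 z] partialIm (partialRe h) := by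
    filter_upwards [hh2.eventually (by simp)] with w hw using partialRe_partialIm_comm hw
  have c5 := c4.partialIm.self_of_nhds
  rw [eV, eW]
  simp only [planeLaplacian] at hlap ⊢
  rw [c5, c3, c5, c1, c2]
  have hxy : z.re ^ 2 + z.im ^ 2 ≤ R ^ 2 := by
    have := Complex.sq_norm z
    rw [Complex.normSq_apply] at this
    nlinarith [norm_nonneg z]
  generalize partialRe (partialRe φ) z = φxx at *
  generalize partialIm (partialIm φ) z = φyy at *
  generalize partialRe φ z = φx at *
  generalize partialIm φ z = φy at *
  generalize partialRe a z = ax at *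
  generalize partialIm a z = ay at *
  generalize a z = A at *
  generalize partialIm (partialIm (partialRe h)) z = hxyy
  generalize partialRe (partialIm (partialRe h)) z = hxxy
  generalize partialIm (partialIm h) z = hyy
  generalize partialIm (partialRe h) z = hxy
  generalize partialRe (partialRe h) z = hxx
  generalize partialRe h z = p
  generalize partialIm h z = q
  generalize h z = H
  have hlt : 0 < lam := by positivity
  have h1 : (t / (2 * R)) ^ 2 = lam * t / 2 := by rw [hlam]; field_simp
  have h2 : lam * R ^ 2 = t / 2 := by rw [hlam]; field_simp
  have h3 : 0 ≤ lam * t - lam * t / 2 - lam ^ 2 * (z.re ^ 2 + z.im ^ 2) := by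
    have : lam ^ 2 * (z.re ^ 2 + z.im ^ 2) ≤ lam ^ 2 * R ^ 2 := by gcongr
    have h4 : lam ^ 2 * R ^ 2 = lam * t / 2 := by rw [sq, mul_assoc, h2]; ring
    linarith
  have h4 : 0 ≤ (hxx - hyy + φx * p - φy * q) ^ 2 + (2 * hxy + φx * q + φy * p) ^ 2 +
      (φxx + φyy - A) * (p ^ 2 + q ^ 2) +
      A * ((p - lam * H * z.re) ^ 2 + (q - lam * H * z.im) ^ 2) +
      A * H ^ 2 * (lam * t - lam * t / 2 - lam ^ 2 * (z.re ^ 2 + z.im ^ 2)) +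
      lam * H ^ 2 * -(z.re * ax + z.im * ay + (z.re * φx + z.im * φy + 2 + t) * A) := by
    have h5 : 0 ≤ φxx + φyy - A := by linarith
    have h6 := neg_nonneg.2 hrad
    positivity
  have h5 := mul_nonneg (Real.exp_pos (φ z)).le h4
  rw [h1]
  linarith

theorem carleman {h φ a : ℂ → ℝ} {t R : ℝ} {Ω : Set ℂ} (hh : ContDiff ℝ 3 h)
    (hc : HasCompactSupport h) (hsub : tsupport h ⊆ Ω) (hφ : ∀ z ∈ Ω, ContDiffAt ℝ 2 φ z)
    (ha : ∀ z ∈ Ω, ContDiffAt ℝ 1 a z) (ha0 : ∀ z ∈ Ω, 0 ≤ a z)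
    (hlap : ∀ z ∈ Ω, a z ≤ planeLaplacian φ z)
    (hrad : ∀ z ∈ Ω, z.re * partialRe a z + z.im * partialIm a z +
      (z.re * partialRe φ z + z.im * partialIm φ z + 2 + t) * a z ≤ 0)
    (hzR : ∀ z ∈ Ω, ‖z‖ ≤ R) (hR : 0 < R) (ht : 0 < t) :
    Integrable (fun z => h z ^ 2 * (a z * Real.exp (φ z))) ∧
    Integrable (fun z => planeLaplacian h z ^ 2 * Real.exp (φ z)) ∧
    (t / (2 * R)) ^ 2 * ∫ z, h z ^ 2 * (a z * Real.exp (φ z)) ≤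
      ∫ z, planeLaplacian h z ^ 2 * Real.exp (φ z) := by
  obtain ⟨V, hV⟩ : ∃ V : ℂ → ℝ, V = fun z => Real.exp (φ z) *
      (2 * (partialRe h z * partialIm (partialIm h) z - partialIm h z * partialIm (partialRe h) z) -
        (partialRe h z ^ 2 + partialIm h z ^ 2) * partialRe φ z +
        t / (2 * R ^ 2) * h z ^ 2 * a z * z.re) := ⟨_, rfl⟩
  obtain ⟨W, hW⟩ : ∃ W : ℂ → ℝ, W = fun z => Real.exp (φ z) *
      (2 * (partialIm h z * partialRe (partialRe h) z - partialRe h z * partialRe (partialIm h) z) -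
        (partialRe h z ^ 2 + partialIm h z ^ 2) * partialIm φ z +
        t / (2 * R ^ 2) * h z ^ 2 * a z * z.im) := ⟨_, rfl⟩
  have h0 : ∀ z ∉ tsupport h, h =ᶠ[𝓝 z] fun _ => 0 := fun z hz => by
    filter_upwards [(isClosed_tsupport h).isOpen_compl.mem_nhds hz] with w hw
    exact image_eq_zero_of_notMem_tsupport hw
  have hp0 : ∀ z ∉ tsupport h, partialRe h =ᶠ[𝓝 z] fun _ => 0 := fun z hz => by
    simpa using (h0 z hz).partialRe
  have hq0 : ∀ z ∉ tsupport h, partialIm h =ᶠ[𝓝 z] fun _ => 0 := fun z hz => by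
    simpa using (h0 z hz).partialIm
  have hl0 : ∀ z ∉ tsupport h, planeLaplacian h z = 0 := fun z hz => by
    have h1 := (hp0 z hz).partialRe.self_of_nhds
    have h2 := (hq0 z hz).partialIm.self_of_nhds
    simp only [partialRe_const, partialIm_const] at h1 h2
    simp [planeLaplacian, h1, h2]
  have hcomp : ∀ {f : ℂ → ℝ}, (∀ z ∉ tsupport h, f z = 0) → HasCompactSupport f := fun hf =>
    hc.mono' fun z hz => by
      by_contra hz'
      exact hz (hf z hz')
  have hpd : ContDiff ℝ 2 (partialRe h) := contDiff_iff_contDiffAt.2 fun z =>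
    hh.contDiffAt.partialRe (by norm_num)
  have hqd : ContDiff ℝ 2 (partialIm h) := contDiff_iff_contDiffAt.2 fun z =>
    hh.contDiffAt.partialIm (by norm_num)
  have hpx : ContDiff ℝ 1 (partialRe (partialRe h)) := contDiff_iff_contDiffAt.2 fun z =>
    hpd.contDiffAt.partialRe (by norm_num)
  have hpy : ContDiff ℝ 1 (partialIm (partialRe h)) := contDiff_iff_contDiffAt.2 fun z =>
    hpd.contDiffAt.partialIm (by norm_num)
  have hqx : ContDiff ℝ 1 (partialRe (partialIm h)) := contDiff_iff_contDiffAt.2 fun z =>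
    hqd.contDiffAt.partialRe (by norm_num)
  have hqy : ContDiff ℝ 1 (partialIm (partialIm h)) := contDiff_iff_contDiffAt.2 fun z =>
    hqd.contDiffAt.partialIm (by norm_num)
  have hre : ContDiff ℝ 1 fun z : ℂ => z.re := Complex.reCLM.contDiff
  have him : ContDiff ℝ 1 fun z : ℂ => z.im := Complex.imCLM.contDiff
  have hp1 : ContDiff ℝ 1 (partialRe h) := hpd.of_le (by norm_num)
  have hq1 : ContDiff ℝ 1 (partialIm h) := hqd.of_le (by norm_num)
  have hh1 : ContDiff ℝ 1 h := hh.of_le (by norm_num)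
  have hV0 : ∀ z ∉ tsupport h, V z = 0 := fun z hz => by
    simp [hV, (hp0 z hz).self_of_nhds, (hq0 z hz).self_of_nhds, (h0 z hz).self_of_nhds]
  have hW0 : ∀ z ∉ tsupport h, W z = 0 := fun z hz => by
    simp [hW, (hp0 z hz).self_of_nhds, (hq0 z hz).self_of_nhds, (h0 z hz).self_of_nhds]
  have hVd : ContDiff ℝ 1 V := by
    refine contDiff_of_eq_zero_off_tsupport hsub (fun z hz => ?_) hV0
    have h1 := (hφ z hz).of_le (m := 1) (by norm_num)
    have h2 := (hφ z hz).partialRe (m := 1) (by norm_num)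
    have h3 := ha z hz
    rw [hV]
    fun_prop
  have hWd : ContDiff ℝ 1 W := by
    refine contDiff_of_eq_zero_off_tsupport hsub (fun z hz => ?_) hW0
    have h1 := (hφ z hz).of_le (m := 1) (by norm_num)
    have h2 := (hφ z hz).partialIm (m := 1) (by norm_num)
    have h3 := ha z hz
    rw [hW]
    fun_prop
  obtain ⟨iV, eV⟩ := integral_fderiv_apply_eq_zero hVd (hcomp hV0) 1
  obtain ⟨iW, eW⟩ := integral_fderiv_apply_eq_zero hWd (hcomp hW0) Complex.I
  have z1 : ∀ z ∉ tsupport h, h z ^ 2 * (a z * Real.exp (φ z)) = 0 := fun z hz => by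
    simp [(h0 z hz).self_of_nhds]
  have z2 : ∀ z ∉ tsupport h, planeLaplacian h z ^ 2 * Real.exp (φ z) = 0 := fun z hz => by
    simp [hl0 z hz]
  have hld : ContDiff ℝ 1 (planeLaplacian h) := hpx.add hqy
  have i1 : Integrable (fun z => h z ^ 2 * (a z * Real.exp (φ z))) := by
    refine (contDiff_of_eq_zero_off_tsupport (n := 1) hsub (fun z hz => ?_)
      z1).continuous.integrable_of_hasCompactSupport (hcomp z1)
    have h1 := (hφ z hz).of_le (m := 1) (by norm_num)
    have h3 := ha z hz
    fun_prop
  have i2 : Integrable (fun z => planeLaplacian h z ^ 2 * Real.exp (φ z)) := by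
    refine (contDiff_of_eq_zero_off_tsupport (n := 1) hsub (fun z hz => ?_)
      z2).continuous.integrable_of_hasCompactSupport (hcomp z2)
    have h1 := (hφ z hz).of_le (m := 1) (by norm_num)
    fun_prop
  refine ⟨i1, i2, ?_⟩
  have i3 : Integrable fun z => partialRe V z := iV
  have i4 : Integrable fun z => partialIm W z := iW
  have key : ∫ z, ((t / (2 * R)) ^ 2 * (h z ^ 2 * (a z * Real.exp (φ z))) +
      (partialRe V z + partialIm W z)) ≤ ∫ z, planeLaplacian h z ^ 2 * Real.exp (φ z) := by
    refine integral_mono ((i1.const_mul _).add (i3.add i4)) i2 fun z => ?_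
    by_cases hz : z ∈ tsupport h
    · have hz' := hsub hz
      exact carleman_pointwise hh.contDiffAt (hφ z hz') (ha z hz') (ha0 z hz') (hlap z hz')
        (hrad z hz') (hzR z hz') hR ht hV hW
    · have hV' : V =ᶠ[𝓝 z] fun _ => 0 := by
        filter_upwards [(isClosed_tsupport h).isOpen_compl.mem_nhds hz] with w hw using hV0 w hw
      have hW' : W =ᶠ[𝓝 z] fun _ => 0 := by
        filter_upwards [(isClosed_tsupport h).isOpen_compl.mem_nhds hz] with w hw using hW0 w hw
      have h1 := hV'.partialRe.self_of_nhds
      have h2 := hW'.partialIm.self_of_nhds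
      simp only [partialRe_const, partialIm_const] at h1 h2
      simp only [z1 z hz, z2 z hz, h1, h2]
      simp
  have i5 : Integrable fun z => partialRe V z + partialIm W z := i3.add i4
  rw [integral_add (i1.const_mul _) i5, integral_add i3 i4, integral_const_mul] at key
  have e1 : ∫ z, partialRe V z = 0 := eV
  have e2 : ∫ z, partialIm W z = 0 := eW
  rw [e1, e2] at key
  simpa using key

theorem measureReal_ball_complex (x : ℂ) {ρ : ℝ} (hρ : 0 ≤ ρ) :
    volume.real (ball x ρ) = Real.pi * ρ ^ 2 := by
  rw [Measure.real, Complex.volume_ball, ENNReal.toReal_mul, ENNReal.toReal_pow,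
    ENNReal.toReal_ofReal hρ]
  simp [mul_comm]

theorem sum_mul_le_integral_of_disjoint_balls {ι : Type} {g : ℂ → ℝ} (hg : Integrable g)
    (hg0 : ∀ w, 0 ≤ g w) {F : Finset ι} {x : ι → ℂ} {ρ : ℝ} (hρ : 0 ≤ ρ)
    (hx : ∀ i ∈ F, ∀ j ∈ F, i ≠ j → 2 * ρ ≤ dist (x i) (x j)) {m : ι → ℝ}
    (hm : ∀ i ∈ F, ∀ w ∈ ball (x i) ρ, m i ≤ g w) :
    (∑ i ∈ F, m i) * (Real.pi * ρ ^ 2) ≤ ∫ w, g w := by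
  calc (∑ i ∈ F, m i) * (Real.pi * ρ ^ 2) = ∑ i ∈ F, m i * volume.real (ball (x i) ρ) := by
        rw [Finset.sum_mul]
        exact Finset.sum_congr rfl fun i _ => by rw [measureReal_ball_complex _ hρ]
    _ ≤ ∑ i ∈ F, ∫ w in ball (x i) ρ, g w := Finset.sum_le_sum fun i hi =>
        setIntegral_ge_of_const_le_real measurableSet_ball measure_ball_lt_top.ne (hm i hi)
          hg.integrableOn
    _ = ∫ w in ⋃ i ∈ F, ball (x i) ρ, g w := by
        rw [integral_biUnion_finset F (fun i _ => measurableSet_ball) _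
          fun i _ => hg.integrableOn]
        intro i hi j hj hij
        exact ball_disjoint_ball (by linarith [hx i hi j hj hij])
    _ ≤ ∫ w, g w := setIntegral_le_integral hg (Eventually.of_forall hg0)

/-- A separated family of points has bounded sums of the inverse fourth power of the distance. -/
theorem exists_sum_inv_sq_le : ∃ K : ℝ, 1 ≤ K ∧ ∀ (ι : Type) (c : ι → ℂ),
    (∀ i j, i ≠ j → 100 ≤ dist (c i) (c j)) → ∀ (F : Finset ι) (z : ℂ),
    ∑ i ∈ F, ((1 + ‖z - c i‖ ^ 2) ^ 2)⁻¹ ≤ K := by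
  have hint : Integrable (fun w : ℂ => ((1 + ‖w‖ ^ 2) ^ 2)⁻¹) := by
    have h := integrable_rpow_neg_one_add_norm_sq (E := ℂ) (μ := volume) (r := 4) (by norm_num)
    refine h.congr (Eventually.of_forall fun w => ?_)
    have : (0 : ℝ) ≤ 1 + ‖w‖ ^ 2 := by positivity
    show ((1 : ℝ) + ‖w‖ ^ 2) ^ (-4 / 2 : ℝ) = _
    rw [show (-4 / 2 : ℝ) = -((2 : ℕ) : ℝ) by norm_num, Real.rpow_neg this, Real.rpow_natCast]
  refine ⟨max 1 (9 / Real.pi * ∫ w : ℂ, ((1 + ‖w‖ ^ 2) ^ 2)⁻¹), le_max_left _ _,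
    fun ι c hc F z => le_max_of_le_right ?_⟩
  have h := sum_mul_le_integral_of_disjoint_balls hint (fun w => by positivity) (F := F)
    (x := fun i => z - c i) (ρ := 1) zero_le_one
    (fun i _ j _ hij => by
      have := hc i j hij
      rw [dist_sub_left]
      linarith) (m := fun i => 1 / 9 * ((1 + ‖z - c i‖ ^ 2) ^ 2)⁻¹) (fun i _ w hw => by
      have h1 : ‖w‖ ≤ ‖z - c i‖ + 1 := by
        have h2 := norm_add_le (w - (z - c i)) (z - c i)
        rw [sub_add_cancel] at h2
        rw [mem_ball, dist_eq_norm] at hw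
        linarith
      have h2 : 1 + ‖w‖ ^ 2 ≤ 3 * (1 + ‖z - c i‖ ^ 2) := by
        nlinarith [norm_nonneg w, mul_self_le_mul_self (norm_nonneg w) h1,
          sq_nonneg (‖z - c i‖ - 1 / 2)]
      have h3 : (1 + ‖w‖ ^ 2) ^ 2 ≤ (3 * (1 + ‖z - c i‖ ^ 2)) ^ 2 := by gcongr
      calc 1 / 9 * ((1 + ‖z - c i‖ ^ 2) ^ 2)⁻¹ = ((3 * (1 + ‖z - c i‖ ^ 2)) ^ 2)⁻¹ := by
            rw [mul_pow, mul_inv]; norm_num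
        _ ≤ _ := by gcongr)
  rw [← Finset.mul_sum] at h
  rw [div_mul_eq_mul_div, le_div_iff₀ Real.pi_pos]
  linarith

theorem finite_setOf_norm_le {ι : Type} {c : ι → ℂ}
    (hc : ∀ i j, i ≠ j → 100 ≤ dist (c i) (c j)) (R : ℝ) : {i | ‖c i‖ ≤ R}.Finite := by
  obtain ⟨K, -, hK⟩ := exists_sum_inv_sq_le
  by_contra hinf
  set b := ((1 + R ^ 2) ^ 2)⁻¹ with hb
  have hb0 : 0 < b := by positivity
  obtain ⟨n, hn⟩ := exists_nat_gt (K / b)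
  obtain ⟨F, hF, hFn⟩ := Set.Infinite.exists_subset_card_eq hinf n
  have h1 := hK ι c hc F 0
  have h2 : ∑ i ∈ F, b ≤ ∑ i ∈ F, ((1 + ‖0 - c i‖ ^ 2) ^ 2)⁻¹ := by
    refine Finset.sum_le_sum fun i hi => ?_
    have h3 : ‖c i‖ ≤ R := hF hi
    rw [hb, zero_sub, norm_neg]
    gcongr
  rw [Finset.sum_const, hFn, nsmul_eq_mul] at h2
  rw [div_lt_iff₀ hb0] at hn
  linarith

theorem partialRe_add {f g : ℂ → ℝ} {z : ℂ} (hf : DifferentiableAt ℝ f z)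
    (hg : DifferentiableAt ℝ g z) :
    partialRe (fun w => f w + g w) z = partialRe f z + partialRe g z := by
  simp [partialRe, fderiv_fun_add hf hg]

theorem partialIm_add {f g : ℂ → ℝ} {z : ℂ} (hf : DifferentiableAt ℝ f z)
    (hg : DifferentiableAt ℝ g z) :
    partialIm (fun w => f w + g w) z = partialIm f z + partialIm g z := by
  simp [partialIm, fderiv_fun_add hf hg]

theorem partialRe_const_mul {f : ℂ → ℝ} {z : ℂ} (hf : DifferentiableAt ℝ f z) (b : ℝ) :
    partialRe (fun w => b * f w) z = b * partialRe f z := by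
  simp [partialRe, fderiv_const_mul hf b]

theorem partialIm_const_mul {f : ℂ → ℝ} {z : ℂ} (hf : DifferentiableAt ℝ f z) (b : ℝ) :
    partialIm (fun w => b * f w) z = b * partialIm f z := by
  simp [partialIm, fderiv_const_mul hf b]

theorem partialRe_mul {f g : ℂ → ℝ} {z : ℂ} (hf : DifferentiableAt ℝ f z)
    (hg : DifferentiableAt ℝ g z) :
    partialRe (fun w => f w * g w) z = partialRe f z * g z + f z * partialRe g z := by
  simp only [partialRe, fderiv_fun_mul hf hg]
  simp; ring

theorem partialIm_mul {f g : ℂ → ℝ} {z : ℂ} (hf : DifferentiableAt ℝ f z)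
    (hg : DifferentiableAt ℝ g z) :
    partialIm (fun w => f w * g w) z = partialIm f z * g z + f z * partialIm g z := by
  simp only [partialIm, fderiv_fun_mul hf hg]
  simp; ring

theorem partialRe_sum {ι : Type} {F : Finset ι} {f : ι → ℂ → ℝ} {z : ℂ}
    (hf : ∀ i ∈ F, DifferentiableAt ℝ (f i) z) :
    partialRe (fun w => ∑ i ∈ F, f i w) z = ∑ i ∈ F, partialRe (f i) z := by
  simp [partialRe, fderiv_fun_sum hf]

theorem partialIm_sum {ι : Type} {F : Finset ι} {f : ι → ℂ → ℝ} {z : ℂ}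
    (hf : ∀ i ∈ F, DifferentiableAt ℝ (f i) z) :
    partialIm (fun w => ∑ i ∈ F, f i w) z = ∑ i ∈ F, partialIm (f i) z := by
  simp [partialIm, fderiv_fun_sum hf]

theorem ContDiffAt.eventually_differentiableAt {f : ℂ → ℝ} {z : ℂ} (hf : ContDiffAt ℝ 2 f z) :
    ∀ᶠ w in 𝓝 z, DifferentiableAt ℝ f w := by
  filter_upwards [hf.eventually (by simp)] with w hw using hw.differentiableAt (by norm_num)

theorem ContDiffAt.differentiableAt_partialRe {f : ℂ → ℝ} {z : ℂ} (hf : ContDiffAt ℝ 2 f z) :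
    DifferentiableAt ℝ (_root_.partialRe f) z :=
  (hf.partialRe (m := 1) (by norm_num)).differentiableAt (by norm_num)

theorem ContDiffAt.differentiableAt_partialIm {f : ℂ → ℝ} {z : ℂ} (hf : ContDiffAt ℝ 2 f z) :
    DifferentiableAt ℝ (_root_.partialIm f) z :=
  (hf.partialIm (m := 1) (by norm_num)).differentiableAt (by norm_num)

theorem planeLaplacian_add {f g : ℂ → ℝ} {z : ℂ} (hf : ContDiffAt ℝ 2 f z)
    (hg : ContDiffAt ℝ 2 g z) :
    planeLaplacian (fun w => f w + g w) z = planeLaplacian f z + planeLaplacian g z := by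
  have h1 : partialRe (fun w => f w + g w) =ᶠ[𝓝 z] fun w => partialRe f w + partialRe g w := by
    filter_upwards [hf.eventually_differentiableAt, hg.eventually_differentiableAt] with w h h'
      using partialRe_add h h'
  have h2 : partialIm (fun w => f w + g w) =ᶠ[𝓝 z] fun w => partialIm f w + partialIm g w := by
    filter_upwards [hf.eventually_differentiableAt, hg.eventually_differentiableAt] with w h h'
      using partialIm_add h h'
  rw [planeLaplacian, h1.partialRe.self_of_nhds, h2.partialIm.self_of_nhds,
    partialRe_add hf.differentiableAt_partialRe hg.differentiableAt_partialRe,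
    partialIm_add hf.differentiableAt_partialIm hg.differentiableAt_partialIm]
  simp only [planeLaplacian]
  ring

theorem planeLaplacian_const_mul {f : ℂ → ℝ} {z : ℂ} (hf : ContDiffAt ℝ 2 f z) (b : ℝ) :
    planeLaplacian (fun w => b * f w) z = b * planeLaplacian f z := by
  have h1 : partialRe (fun w => b * f w) =ᶠ[𝓝 z] fun w => b * partialRe f w := by
    filter_upwards [hf.eventually_differentiableAt] with w h using partialRe_const_mul h b
  have h2 : partialIm (fun w => b * f w) =ᶠ[𝓝 z] fun w => b * partialIm f w := by
    filter_upwards [hf.eventually_differentiableAt] with w h using partialIm_const_mul h b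
  rw [planeLaplacian, h1.partialRe.self_of_nhds, h2.partialIm.self_of_nhds,
    partialRe_const_mul hf.differentiableAt_partialRe,
    partialIm_const_mul hf.differentiableAt_partialIm]
  simp only [planeLaplacian]
  ring

theorem planeLaplacian_sum {ι : Type} {F : Finset ι} {f : ι → ℂ → ℝ} {z : ℂ}
    (hf : ∀ i ∈ F, ContDiffAt ℝ 2 (f i) z) :
    planeLaplacian (fun w => ∑ i ∈ F, f i w) z = ∑ i ∈ F, planeLaplacian (f i) z := by
  have h0 : ∀ᶠ w in 𝓝 z, ∀ i ∈ F, DifferentiableAt ℝ (f i) w :=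
    F.eventually_all.2 fun i hi => (hf i hi).eventually_differentiableAt
  have h1 : partialRe (fun w => ∑ i ∈ F, f i w) =ᶠ[𝓝 z] fun w => ∑ i ∈ F, partialRe (f i) w := by
    filter_upwards [h0] with w h using partialRe_sum h
  have h2 : partialIm (fun w => ∑ i ∈ F, f i w) =ᶠ[𝓝 z] fun w => ∑ i ∈ F, partialIm (f i) w := by
    filter_upwards [h0] with w h using partialIm_sum h
  rw [planeLaplacian, h1.partialRe.self_of_nhds, h2.partialIm.self_of_nhds,
    partialRe_sum fun i hi => (hf i hi).differentiableAt_partialRe,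
    partialIm_sum fun i hi => (hf i hi).differentiableAt_partialIm, ← Finset.sum_add_distrib]
  simp only [planeLaplacian]

theorem planeLaplacian_mul {f g : ℂ → ℝ} {z : ℂ} (hf : ContDiffAt ℝ 2 f z)
    (hg : ContDiffAt ℝ 2 g z) :
    planeLaplacian (fun w => f w * g w) z = planeLaplacian f z * g z +
      2 * (partialRe f z * partialRe g z + partialIm f z * partialIm g z) +
      f z * planeLaplacian g z := by
  have hf1 := hf.differentiableAt (by norm_num)
  have hg1 := hg.differentiableAt (by norm_num)
  have hfp := hf.differentiableAt_partialRe
  have hfq := hf.differentiableAt_partialIm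
  have hgp := hg.differentiableAt_partialRe
  have hgq := hg.differentiableAt_partialIm
  have h1 : partialRe (fun w => f w * g w) =ᶠ[𝓝 z]
      fun w => partialRe f w * g w + f w * partialRe g w := by
    filter_upwards [hf.eventually_differentiableAt, hg.eventually_differentiableAt] with w h h'
      using partialRe_mul h h'
  have h2 : partialIm (fun w => f w * g w) =ᶠ[𝓝 z]
      fun w => partialIm f w * g w + f w * partialIm g w := by
    filter_upwards [hf.eventually_differentiableAt, hg.eventually_differentiableAt] with w h h'
      using partialIm_mul h h'
  rw [planeLaplacian, h1.partialRe.self_of_nhds, h2.partialIm.self_of_nhds,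
    partialRe_add (hfp.fun_mul hg1) (hf1.fun_mul hgp), partialIm_add (hfq.fun_mul hg1) (hf1.fun_mul hgq),
    partialRe_mul hfp hg1, partialRe_mul hf1 hgp, partialIm_mul hfq hg1, partialIm_mul hf1 hgq]
  simp only [planeLaplacian]
  ring

theorem hasFDerivAt_norm_sub_sq (c z : ℂ) : HasFDerivAt (fun w : ℂ => ‖w - c‖ ^ 2)
    ((2 * (z - c).re) • Complex.reCLM + (2 * (z - c).im) • Complex.imCLM) z := by
  have h : (fun w : ℂ => ‖w - c‖ ^ 2) = fun w => (w.re - c.re) ^ 2 + (w.im - c.im) ^ 2 := by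
    funext w
    rw [Complex.sq_norm, Complex.normSq_apply, Complex.sub_re, Complex.sub_im]
    ring
  rw [h]
  have hre : HasFDerivAt (fun z : ℂ => z.re) Complex.reCLM z := Complex.reCLM.hasFDerivAt
  have him : HasFDerivAt (fun z : ℂ => z.im) Complex.imCLM z := Complex.imCLM.hasFDerivAt
  refine (((hre.sub_const c.re).pow 2).add ((him.sub_const c.im).pow 2)).congr_fderiv ?_
  ext
  simp

theorem partialRe_radial {g : ℝ → ℝ} {c z : ℂ} {g' : ℝ} (hg : HasDerivAt g g' (‖z - c‖ ^ 2)) :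
    partialRe (fun w => g (‖w - c‖ ^ 2)) z = 2 * (z - c).re * g' := by
  have h := hg.comp_hasFDerivAt z (hasFDerivAt_norm_sub_sq c z)
  rw [partialRe]
  refine (congrArg (fun L : ℂ →L[ℝ] ℝ => L 1) h.fderiv).trans ?_
  simp
  ring

theorem partialIm_radial {g : ℝ → ℝ} {c z : ℂ} {g' : ℝ} (hg : HasDerivAt g g' (‖z - c‖ ^ 2)) :
    partialIm (fun w => g (‖w - c‖ ^ 2)) z = 2 * (z - c).im * g' := by
  have h := hg.comp_hasFDerivAt z (hasFDerivAt_norm_sub_sq c z)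
  rw [partialIm]
  refine (congrArg (fun L : ℂ →L[ℝ] ℝ => L Complex.I) h.fderiv).trans ?_
  simp
  ring

theorem planeLaplacian_radial {g g₁ : ℝ → ℝ} {c z : ℂ} {g₂ : ℝ}
    (hg : ∀ᶠ s in 𝓝 (‖z - c‖ ^ 2), HasDerivAt g (g₁ s) s)
    (hg₁ : HasDerivAt g₁ g₂ (‖z - c‖ ^ 2)) :
    planeLaplacian (fun w => g (‖w - c‖ ^ 2)) z =
      4 * g₁ (‖z - c‖ ^ 2) + 4 * ‖z - c‖ ^ 2 * g₂ := by
  have hcont : Tendsto (fun w : ℂ => ‖w - c‖ ^ 2) (𝓝 z) (𝓝 (‖z - c‖ ^ 2)) :=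
    (hasFDerivAt_norm_sub_sq c z).continuousAt
  have h1 : partialRe (fun w => g (‖w - c‖ ^ 2)) =ᶠ[𝓝 z]
      fun w => (2 * (w - c).re) * g₁ (‖w - c‖ ^ 2) := by
    filter_upwards [hcont.eventually hg] with w hw using partialRe_radial hw
  have h2 : partialIm (fun w => g (‖w - c‖ ^ 2)) =ᶠ[𝓝 z]
      fun w => (2 * (w - c).im) * g₁ (‖w - c‖ ^ 2) := by
    filter_upwards [hcont.eventually hg] with w hw using partialIm_radial hw
  have hd : DifferentiableAt ℝ (fun w : ℂ => g₁ (‖w - c‖ ^ 2)) z :=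
    (hg₁.comp_hasFDerivAt z (hasFDerivAt_norm_sub_sq c z)).differentiableAt
  have hre : HasFDerivAt (fun w : ℂ => 2 * (w - c).re) ((2 : ℝ) • Complex.reCLM) z := by
    simpa using ((Complex.reCLM.hasFDerivAt (x := z)).sub_const c.re).const_mul 2
  have him : HasFDerivAt (fun w : ℂ => 2 * (w - c).im) ((2 : ℝ) • Complex.imCLM) z := by
    simpa using ((Complex.imCLM.hasFDerivAt (x := z)).sub_const c.im).const_mul 2
  have e1 : partialRe (fun w : ℂ => 2 * (w - c).re) z = 2 := by
    rw [partialRe, hre.fderiv]; simp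
  have e2 : partialIm (fun w : ℂ => 2 * (w - c).im) z = 2 := by
    rw [partialIm, him.fderiv]; simp
  rw [planeLaplacian, h1.partialRe.self_of_nhds, h2.partialIm.self_of_nhds,
    partialRe_mul hre.differentiableAt hd, partialIm_mul him.differentiableAt hd,
    partialRe_radial hg₁, partialIm_radial hg₁, e1, e2]
  rw [Complex.sq_norm, Complex.normSq_apply]
  ring

theorem contDiffAt_radial {g : ℝ → ℝ} {c z : ℂ} {n : WithTop ℕ∞}
    (hg : ContDiffAt ℝ n g (‖z - c‖ ^ 2)) : ContDiffAt ℝ n (fun w => g (‖w - c‖ ^ 2)) z :=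
  hg.comp z ((contDiff_id.sub contDiff_const).norm_sq ℝ).contDiffAt

/-- The logarithmic Carleman weight, convexified around the centers `c i`. -/
def carlemanWeight {ι : Type} (c : ι → ℂ) (J : Finset ι) (t R : ℝ) (z : ℂ) : ℝ :=
  -t * Real.log (‖z‖ ^ 2) + (R ^ 2)⁻¹ * ‖z‖ ^ 2 + ∑ i ∈ J, ((1 + ‖z - c i‖ ^ 2) ^ 2)⁻¹

/-- A lower bound for the Laplacian of `carlemanWeight`. -/
def carlemanDensity {ι : Type} (c : ι → ℂ) (J : Finset ι) (R : ℝ) (z : ℂ) : ℝ :=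
  4 * (R ^ 2)⁻¹ + 11 * ∑ i ∈ J, ((1 + ‖z - c i‖ ^ 2) ^ 3)⁻¹

theorem hasDerivAt_inv_one_add_pow (n : ℕ) {s : ℝ} (hs : 0 ≤ s) :
    HasDerivAt (fun s : ℝ => ((1 + s) ^ (n + 1))⁻¹) (-(n + 1) * ((1 + s) ^ (n + 2))⁻¹) s := by
  have h1 : 1 + s ≠ 0 := by positivity
  have h := (((hasDerivAt_id s).const_add 1).fun_pow (n + 1)).fun_inv (pow_ne_zero _ h1)
  refine h.congr_deriv ?_
  simp only [id]
  field_simp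
  push_cast
  ring_nf

section

variable {ι : Type} {c : ι → ℂ} {J : Finset ι} {t R : ℝ} {z : ℂ}

theorem contDiffAt_inv_one_add_pow (n : ℕ) (m : WithTop ℕ∞) (b z : ℂ) :
    ContDiffAt ℝ m (fun w => ((1 + ‖w - b‖ ^ 2) ^ n)⁻¹) z := by
  refine contDiffAt_radial (g := fun s => ((1 + s) ^ n)⁻¹) ?_
  have h1 : (1 + ‖z - b‖ ^ 2) ^ n ≠ 0 := by positivity
  have h2 : ContDiffAt ℝ m (fun s : ℝ => (1 + s) ^ n) (‖z - b‖ ^ 2) := by fun_prop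
  exact h2.fun_inv h1

theorem contDiffAt_log_norm_sq (hz : z ≠ 0) (m : WithTop ℕ∞) :
    ContDiffAt ℝ m (fun w : ℂ => Real.log (‖w‖ ^ 2)) z := by
  have := contDiffAt_radial (g := Real.log) (c := 0) (z := z) (n := m)
    (Real.contDiffAt_log.2 (by simpa using hz))
  simpa using this

theorem contDiffAt_norm_sq (m : WithTop ℕ∞) : ContDiffAt ℝ m (fun w : ℂ => ‖w‖ ^ 2) z :=
  (contDiff_id.norm_sq ℝ).contDiffAt

theorem contDiffAt_carlemanWeight (hz : z ≠ 0) (m : WithTop ℕ∞) :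
    ContDiffAt ℝ m (carlemanWeight c J t R) z :=
  (((contDiffAt_log_norm_sq hz m).const_smul (-t)).add
    ((contDiffAt_norm_sq m).const_smul ((R ^ 2)⁻¹))).add
      (ContDiffAt.sum fun i _ => contDiffAt_inv_one_add_pow 2 m (c i) z)

theorem contDiffAt_carlemanDensity (m : WithTop ℕ∞) :
    ContDiffAt ℝ m (carlemanDensity c J R) z :=
  contDiffAt_const.add ((ContDiffAt.sum fun i _ =>
    contDiffAt_inv_one_add_pow 3 m (c i) z).const_smul (11 : ℝ))

theorem carlemanDensity_nonneg : 0 ≤ carlemanDensity c J R z := by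
  have : 0 ≤ ∑ i ∈ J, ((1 + ‖z - c i‖ ^ 2) ^ 3)⁻¹ := Finset.sum_nonneg fun i _ => by positivity
  rw [carlemanDensity]
  positivity

theorem planeLaplacian_log_norm_sq (hz : z ≠ 0) :
    planeLaplacian (fun w : ℂ => Real.log (‖w‖ ^ 2)) z = 0 := by
  have hs : 0 < ‖z - 0‖ ^ 2 := by rw [sub_zero]; positivity
  have h := planeLaplacian_radial (g := Real.log) (g₁ := fun s => s⁻¹) (c := 0) (z := z)
    (by filter_upwards [lt_mem_nhds hs] with s h using Real.hasDerivAt_log h.ne')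
    (hasDerivAt_inv hs.ne')
  simp only [sub_zero] at h hs
  rw [h]
  field_simp
  ring

theorem planeLaplacian_norm_sq : planeLaplacian (fun w : ℂ => ‖w‖ ^ 2) z = 4 := by
  have h := planeLaplacian_radial (g := fun s => s) (g₁ := fun _ => 1) (c := 0) (z := z)
    (Eventually.of_forall fun s => hasDerivAt_id s) (hasDerivAt_const _ _)
  simpa using h

theorem le_planeLaplacian_inv_sq (b : ℂ) (hz : 2 ≤ ‖z - b‖) :
    11 * ((1 + ‖z - b‖ ^ 2) ^ 3)⁻¹ ≤ planeLaplacian (fun w => ((1 + ‖w - b‖ ^ 2) ^ 2)⁻¹) z := by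
  have hs : 4 ≤ ‖z - b‖ ^ 2 := by nlinarith
  have h := planeLaplacian_radial (g := fun s => ((1 + s) ^ 2)⁻¹)
    (g₁ := fun s => -2 * ((1 + s) ^ 3)⁻¹) (c := b) (z := z)
    (by
      filter_upwards [lt_mem_nhds (show (0 : ℝ) < ‖z - b‖ ^ 2 by linarith)] with s h
      refine (hasDerivAt_inv_one_add_pow 1 h.le).congr_deriv ?_
      norm_num)
    ((hasDerivAt_inv_one_add_pow 2 (by positivity)).const_mul _)
  rw [h]
  generalize ‖z - b‖ ^ 2 = s at *
  have : 0 < 1 + s := by linarith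
  have e : 4 * (-2 * ((1 + s) ^ 3)⁻¹) + 4 * s * (-2 * (-(((2 : ℕ) : ℝ) + 1) *
      ((1 + s) ^ (2 + 2))⁻¹)) - 11 * ((1 + s) ^ 3)⁻¹ = (5 * s - 19) * ((1 + s) ^ 4)⁻¹ := by
    push_cast
    field_simp
    ring
  have h2 : 0 ≤ (5 * s - 19) * ((1 + s) ^ 4)⁻¹ := mul_nonneg (by linarith) (by positivity)
  linarith

theorem carlemanDensity_le_planeLaplacian (hz : z ≠ 0) (hJ : ∀ i ∈ J, 2 ≤ ‖z - c i‖) :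
    carlemanDensity c J R z ≤ planeLaplacian (carlemanWeight c J t R) z := by
  have h1 := contDiffAt_log_norm_sq hz 2
  have h2 := contDiffAt_norm_sq (z := z) 2
  have h3 : ∀ i ∈ J, ContDiffAt ℝ 2 (fun w => ((1 + ‖w - c i‖ ^ 2) ^ 2)⁻¹) z := fun i _ =>
    contDiffAt_inv_one_add_pow 2 2 (c i) z
  have e : planeLaplacian (carlemanWeight c J t R) z = 4 * (R ^ 2)⁻¹ +
      ∑ i ∈ J, planeLaplacian (fun w => ((1 + ‖w - c i‖ ^ 2) ^ 2)⁻¹) z := by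
    have h1' : ContDiffAt ℝ 2 (fun w : ℂ => -t * Real.log (‖w‖ ^ 2)) z := h1.const_smul (-t)
    have h2' : ContDiffAt ℝ 2 (fun w : ℂ => (R ^ 2)⁻¹ * ‖w‖ ^ 2) z := h2.const_smul ((R ^ 2)⁻¹)
    show planeLaplacian (fun w => _ + _) z = _
    rw [planeLaplacian_add (h1'.add h2') (ContDiffAt.sum h3), planeLaplacian_add h1' h2',
      planeLaplacian_sum h3, planeLaplacian_const_mul h1, planeLaplacian_const_mul h2,
      planeLaplacian_log_norm_sq hz, planeLaplacian_norm_sq]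
    ring
  rw [e, carlemanDensity, Finset.mul_sum]
  gcongr with i hi
  exact le_planeLaplacian_inv_sq (c i) (hJ i hi)

/-- The radial derivative of `f`, multiplied by the distance to the origin. -/
def eulerDeriv (f : ℂ → ℝ) (z : ℂ) : ℝ := z.re * partialRe f z + z.im * partialIm f z

theorem eulerDeriv_radial {g : ℝ → ℝ} {b z : ℂ} {g' : ℝ} (hg : HasDerivAt g g' (‖z - b‖ ^ 2)) :
    eulerDeriv (fun w => g (‖w - b‖ ^ 2)) z =
      2 * (z.re * (z - b).re + z.im * (z - b).im) * g' := by
  rw [eulerDeriv, partialRe_radial hg, partialIm_radial hg]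
  ring

theorem abs_re_mul_re_add_im_mul_im_le (z w : ℂ) :
    |z.re * w.re + z.im * w.im| ≤ ‖z‖ * ‖w‖ := by
  refine abs_le_of_sq_le_sq ?_ (by positivity)
  rw [mul_pow, Complex.sq_norm, Complex.sq_norm, Complex.normSq_apply, Complex.normSq_apply]
  nlinarith [sq_nonneg (z.re * w.im - z.im * w.re)]

theorem abs_eulerDeriv_inv_pow_le (n : ℕ) (b z : ℂ) :
    |eulerDeriv (fun w => ((1 + ‖w - b‖ ^ 2) ^ (n + 1))⁻¹) z| ≤
      (n + 1) * ‖z‖ * ((1 + ‖z - b‖ ^ 2) ^ (n + 1))⁻¹ := by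
  rw [eulerDeriv_radial (g := fun s => ((1 + s) ^ (n + 1))⁻¹)
    (hasDerivAt_inv_one_add_pow n (by positivity)), abs_mul, abs_mul, abs_mul, abs_neg,
    abs_of_nonneg (show (0 : ℝ) ≤ n + 1 by positivity), abs_two,
    abs_of_nonneg (show 0 ≤ ((1 + ‖z - b‖ ^ 2) ^ (n + 2))⁻¹ by positivity)]
  have h1 := abs_re_mul_re_add_im_mul_im_le z (z - b)
  have h2 : 2 * ‖z - b‖ ≤ 1 + ‖z - b‖ ^ 2 := by nlinarith [sq_nonneg (‖z - b‖ - 1)]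
  calc 2 * |z.re * (z - b).re + z.im * (z - b).im| * ((n + 1) * ((1 + ‖z - b‖ ^ 2) ^ (n + 2))⁻¹)
      ≤ 2 * (‖z‖ * ‖z - b‖) * ((n + 1) * ((1 + ‖z - b‖ ^ 2) ^ (n + 2))⁻¹) := by gcongr
    _ = (n + 1) * ‖z‖ * (2 * ‖z - b‖ * ((1 + ‖z - b‖ ^ 2) ^ (n + 2))⁻¹) := by ring
    _ ≤ (n + 1) * ‖z‖ * ((1 + ‖z - b‖ ^ 2) * ((1 + ‖z - b‖ ^ 2) ^ (n + 2))⁻¹) := by gcongr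
    _ = _ := by
      congr 1
      have : (1 + ‖z - b‖ ^ 2) ≠ 0 := by positivity
      field_simp
      ring

theorem eulerDeriv_add {f g : ℂ → ℝ} (hf : DifferentiableAt ℝ f z) (hg : DifferentiableAt ℝ g z) :
    eulerDeriv (fun w => f w + g w) z = eulerDeriv f z + eulerDeriv g z := by
  rw [eulerDeriv, partialRe_add hf hg, partialIm_add hf hg, eulerDeriv, eulerDeriv]
  ring

theorem eulerDeriv_const_mul {f : ℂ → ℝ} (hf : DifferentiableAt ℝ f z) (b : ℝ) :
    eulerDeriv (fun w => b * f w) z = b * eulerDeriv f z := by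
  rw [eulerDeriv, partialRe_const_mul hf, partialIm_const_mul hf, eulerDeriv]
  ring

theorem eulerDeriv_sum {f : ι → ℂ → ℝ} (hf : ∀ i ∈ J, DifferentiableAt ℝ (f i) z) :
    eulerDeriv (fun w => ∑ i ∈ J, f i w) z = ∑ i ∈ J, eulerDeriv (f i) z := by
  rw [eulerDeriv, partialRe_sum hf, partialIm_sum hf, Finset.mul_sum, Finset.mul_sum,
    ← Finset.sum_add_distrib]
  rfl

theorem eulerDeriv_carlemanDensity_le (hR : ‖z‖ ≤ R) :
    eulerDeriv (carlemanDensity c J R) z ≤ 3 * R * carlemanDensity c J R z := by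
  have h3 : ∀ i ∈ J, DifferentiableAt ℝ (fun w => ((1 + ‖w - c i‖ ^ 2) ^ 3)⁻¹) z := fun i _ =>
    (contDiffAt_inv_one_add_pow 3 1 (c i) z).differentiableAt (by norm_num)
  have h4 := DifferentiableAt.fun_sum h3
  have hR0 := (norm_nonneg z).trans hR
  show eulerDeriv (fun w => _ + _) z ≤ _
  rw [eulerDeriv_add (differentiableAt_const _) (h4.const_mul _), eulerDeriv_const_mul h4,
    eulerDeriv_sum h3]
  have e0 : eulerDeriv (fun _ => 4 * (R ^ 2)⁻¹) z = 0 := by simp [eulerDeriv]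
  have h5 : ∑ i ∈ J, eulerDeriv (fun w => ((1 + ‖w - c i‖ ^ 2) ^ 3)⁻¹) z ≤
      3 * R * ∑ i ∈ J, ((1 + ‖z - c i‖ ^ 2) ^ 3)⁻¹ := by
    rw [Finset.mul_sum]
    refine Finset.sum_le_sum fun i _ =>
      (le_abs_self _).trans ((abs_eulerDeriv_inv_pow_le 2 (c i) z).trans ?_)
    push_cast
    norm_num
    gcongr
  have h6 : 0 ≤ 3 * R * (4 * (R ^ 2)⁻¹) := by positivity
  rw [e0, carlemanDensity]
  linarith

theorem eulerDeriv_carlemanWeight_le {K : ℝ} (hz : z ≠ 0) (hR : ‖z‖ ≤ R)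
    (hK : ∑ i ∈ J, ((1 + ‖z - c i‖ ^ 2) ^ 2)⁻¹ ≤ K) :
    eulerDeriv (carlemanWeight c J t R) z ≤ -2 * t + 2 + 2 * K * R := by
  have hz0 : 0 < ‖z‖ := norm_pos_iff.2 hz
  have hR0 := hz0.trans_le hR
  have h1 := (contDiffAt_log_norm_sq hz 1).differentiableAt (by norm_num)
  have h2 := (contDiffAt_norm_sq (z := z) 1).differentiableAt (by norm_num)
  have h3 : ∀ i ∈ J, DifferentiableAt ℝ (fun w => ((1 + ‖w - c i‖ ^ 2) ^ 2)⁻¹) z := fun i _ =>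
    (contDiffAt_inv_one_add_pow 2 1 (c i) z).differentiableAt (by norm_num)
  have h4 := DifferentiableAt.fun_sum h3
  show eulerDeriv (fun w => _ + _) z ≤ _
  rw [eulerDeriv_add ((h1.const_mul _).fun_add (h2.const_mul _)) h4,
    eulerDeriv_add (h1.const_mul _) (h2.const_mul _), eulerDeriv_const_mul h1,
    eulerDeriv_const_mul h2, eulerDeriv_sum h3]
  have hns : z.re * z.re + z.im * z.im = ‖z‖ ^ 2 := by
    rw [Complex.sq_norm, Complex.normSq_apply]
  have e1 : eulerDeriv (fun w => Real.log (‖w‖ ^ 2)) z = 2 := by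
    have := eulerDeriv_radial (g := Real.log) (b := 0) (z := z)
      (Real.hasDerivAt_log (by rw [sub_zero]; positivity))
    simp only [sub_zero, hns] at this
    rw [this]
    field_simp
  have e2 : eulerDeriv (fun w => ‖w‖ ^ 2) z = 2 * ‖z‖ ^ 2 := by
    have := eulerDeriv_radial (g := fun s => s) (b := 0) (z := z) (hasDerivAt_id _)
    simp only [sub_zero, hns] at this
    rw [this]
    ring
  have h5 : ∑ i ∈ J, eulerDeriv (fun w => ((1 + ‖w - c i‖ ^ 2) ^ 2)⁻¹) z ≤
      2 * R * ∑ i ∈ J, ((1 + ‖z - c i‖ ^ 2) ^ 2)⁻¹ := by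
    rw [Finset.mul_sum]
    refine Finset.sum_le_sum fun i _ =>
      (le_abs_self _).trans ((abs_eulerDeriv_inv_pow_le 1 (c i) z).trans ?_)
    push_cast
    norm_num
    gcongr
  have h6 : 2 * R * ∑ i ∈ J, ((1 + ‖z - c i‖ ^ 2) ^ 2)⁻¹ ≤ 2 * R * K := by gcongr
  have h7 : (R ^ 2)⁻¹ * (2 * ‖z‖ ^ 2) ≤ 2 := by
    rw [inv_mul_le_iff₀ (by positivity)]
    nlinarith
  rw [e1, e2]
  linarith

theorem carlemanWeight_radial_condition {K : ℝ} (hz : z ≠ 0) (hR : ‖z‖ ≤ R)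
    (hK : ∑ i ∈ J, ((1 + ‖z - c i‖ ^ 2) ^ 2)⁻¹ ≤ K) (ht : 4 + (2 * K + 3) * R ≤ t) :
    eulerDeriv (carlemanDensity c J R) z +
      (eulerDeriv (carlemanWeight c J t R) z + 2 + t) * carlemanDensity c J R z ≤ 0 := by
  have h1 := eulerDeriv_carlemanDensity_le (c := c) (J := J) hR
  have h2 := eulerDeriv_carlemanWeight_le (t := t) hz hR hK
  have h3 := carlemanDensity_nonneg (c := c) (J := J) (R := R) (z := z)
  have h4 : (3 * R + (eulerDeriv (carlemanWeight c J t R) z + 2 + t)) *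
      carlemanDensity c J R z ≤ 0 := mul_nonpos_of_nonpos_of_nonneg (by linarith) h3
  linarith

theorem le_exp_carlemanWeight (hz : z ≠ 0) :
    (‖z‖ ^ 2) ^ (-t) ≤ Real.exp (carlemanWeight c J t R z) := by
  have hz0 : 0 < ‖z‖ := norm_pos_iff.2 hz
  rw [Real.rpow_def_of_pos (by positivity), carlemanWeight]
  have : 0 ≤ ∑ i ∈ J, ((1 + ‖z - c i‖ ^ 2) ^ 2)⁻¹ := Finset.sum_nonneg fun i _ => by positivity
  have h2 : 0 ≤ (R ^ 2)⁻¹ * ‖z‖ ^ 2 := by positivity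
  exact Real.exp_le_exp.2 (by linarith)

theorem exp_carlemanWeight_le {K : ℝ} (hz : z ≠ 0) (hR : ‖z‖ ≤ R)
    (hK : ∑ i ∈ J, ((1 + ‖z - c i‖ ^ 2) ^ 2)⁻¹ ≤ K) :
    Real.exp (carlemanWeight c J t R z) ≤ Real.exp (K + 1) * (‖z‖ ^ 2) ^ (-t) := by
  have hz0 : 0 < ‖z‖ := norm_pos_iff.2 hz
  have hR0 := hz0.trans_le hR
  rw [Real.rpow_def_of_pos (by positivity), carlemanWeight, ← Real.exp_add]
  have h2 : (R ^ 2)⁻¹ * ‖z‖ ^ 2 ≤ 1 := by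
    rw [inv_mul_le_iff₀ (by positivity)]
    nlinarith
  exact Real.exp_le_exp.2 (by linarith)

end

theorem planeLaplacian_eq_laplacian {f : ℂ → ℝ} {z : ℂ} (hf : ContDiffAt ℝ 2 f z) :
    planeLaplacian f z = Laplacian.laplacian f z := by
  have hd : DifferentiableAt ℝ (fderiv ℝ f) z :=
    (hf.fderiv_right (m := 1) (by norm_num)).differentiableAt (by norm_num)
  have h : ∀ b : ℂ, fderiv ℝ (fun w => fderiv ℝ f w b) z b = fderiv ℝ (fderiv ℝ f) z b b := by
    intro b
    rw [fderiv_clm_apply hd (differentiableAt_const b)]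
    simp
  rw [InnerProductSpace.laplacian_eq_iteratedFDeriv_complexPlane]
  simp only [iteratedFDeriv_two_apply, Matrix.cons_val_zero, Matrix.cons_val_one]
  exact congrArg₂ (· + ·) (h 1) (h Complex.I)

/-- `f` is regular at `z`, bounded by one, and its derivatives have the size of those of a cutoff
function at scale `B⁻¹`. -/
structure CutoffBound (f : ℂ → ℝ) (z : ℂ) (B : ℝ) : Prop where
  contDiffAt : ContDiffAt ℝ 3 f z
  abs_le : |f z| ≤ 1
  re_le : |partialRe f z| ≤ B
  im_le : |partialIm f z| ≤ B
  lap_le : |planeLaplacian f z| ≤ B ^ 2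

namespace CutoffBound

variable {f g : ℂ → ℝ} {z : ℂ} {B B₁ B₂ : ℝ}

theorem nonneg (hf : CutoffBound f z B) : 0 ≤ B := (abs_nonneg _).trans hf.re_le

theorem congr (hf : CutoffBound f z B) (h : g =ᶠ[𝓝 z] f) : CutoffBound g z B where
  contDiffAt := hf.contDiffAt.congr_of_eventuallyEq h
  abs_le := h.self_of_nhds ▸ hf.abs_le
  re_le := h.partialRe.self_of_nhds ▸ hf.re_le
  im_le := h.partialIm.self_of_nhds ▸ hf.im_le
  lap_le := h.planeLaplacian.self_of_nhds ▸ hf.lap_le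

theorem const {b : ℝ} (hb : |b| ≤ 1) (hB : 0 ≤ B) : CutoffBound (fun _ => b) z B where
  contDiffAt := contDiffAt_const
  abs_le := hb
  re_le := by simpa
  im_le := by simpa
  lap_le := by simp [planeLaplacian, sq_nonneg]

theorem mul (hf : CutoffBound f z B₁) (hg : CutoffBound g z B₂) :
    CutoffBound (fun w => f w * g w) z (2 * (B₁ + B₂)) := by
  have hf2 : ContDiffAt ℝ 2 f z := hf.contDiffAt.of_le (by norm_num)
  have hg2 : ContDiffAt ℝ 2 g z := hg.contDiffAt.of_le (by norm_num)
  have hfd := hf2.differentiableAt (by norm_num)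
  have hgd := hg2.differentiableAt (by norm_num)
  have h1 := hf.nonneg
  have h2 := hg.nonneg
  have key : ∀ {a b x y p q : ℝ}, |a| ≤ p → |b| ≤ q → |x| ≤ 1 → |y| ≤ 1 → 0 ≤ p → 0 ≤ q →
      |a * y + x * b| ≤ p + q := fun {a b x y p q} ha hb hx hy hp hq =>
    calc |a * y + x * b| ≤ |a| * |y| + |x| * |b| := by
          rw [← abs_mul, ← abs_mul]; exact abs_add_le _ _
      _ ≤ p * 1 + 1 * q := by gcongr
      _ = p + q := by ring
  refine ⟨hf.contDiffAt.mul hg.contDiffAt, ?_, ?_, ?_, ?_⟩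
  · rw [abs_mul]
    exact mul_le_one₀ hf.abs_le (abs_nonneg _) hg.abs_le
  · rw [partialRe_mul hfd hgd]
    linarith [key hf.re_le hg.re_le hf.abs_le hg.abs_le h1 h2]
  · rw [partialIm_mul hfd hgd]
    linarith [key hf.im_le hg.im_le hf.abs_le hg.abs_le h1 h2]
  · rw [planeLaplacian_mul hf2 hg2]
    have h3 := key hf.lap_le hg.lap_le hf.abs_le hg.abs_le (sq_nonneg _) (sq_nonneg _)
    have h4 : |partialRe f z * partialRe g z| ≤ B₁ * B₂ := by
      rw [abs_mul]
      exact mul_le_mul hf.re_le hg.re_le (abs_nonneg _) h1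
    have h5 : |partialIm f z * partialIm g z| ≤ B₁ * B₂ := by
      rw [abs_mul]
      exact mul_le_mul hf.im_le hg.im_le (abs_nonneg _) h1
    rw [_root_.abs_le] at h3 h4 h5 ⊢
    constructor <;> nlinarith [mul_nonneg h1 h2]

theorem abs_planeLaplacian_mul_le (hf : CutoffBound f z B) {v : ℂ → ℝ} (hv : HarmonicAt v z)
    {G : ℝ} (hG : ‖fderiv ℝ v z‖ ≤ G) :
    |planeLaplacian (fun w => v w * f w) z| ≤ |v z| * B ^ 2 + 4 * G * B := by
  have hlap : planeLaplacian v z = 0 := by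
    rw [planeLaplacian_eq_laplacian hv.1]
    exact hv.2.self_of_nhds
  have h1 : |partialRe v z| ≤ G := by
    have := (fderiv ℝ v z).le_opNorm 1
    rw [norm_one, mul_one] at this
    exact this.trans hG
  have h2 : |partialIm v z| ≤ G := by
    have := (fderiv ℝ v z).le_opNorm Complex.I
    rw [Complex.norm_I, mul_one] at this
    exact this.trans hG
  have hG0 : 0 ≤ G := (norm_nonneg _).trans hG
  have h3 : |partialRe v z * partialRe f z| ≤ G * B := by
    rw [abs_mul]
    exact mul_le_mul h1 hf.re_le (abs_nonneg _) hG0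
  have h4 : |partialIm v z * partialIm f z| ≤ G * B := by
    rw [abs_mul]
    exact mul_le_mul h2 hf.im_le (abs_nonneg _) hG0
  have h5 : |v z * planeLaplacian f z| ≤ |v z| * B ^ 2 := by
    rw [abs_mul]
    exact mul_le_mul_of_nonneg_left hf.lap_le (abs_nonneg _)
  rw [planeLaplacian_mul hv.1 (hf.contDiffAt.of_le (by norm_num)), hlap, zero_mul, zero_add]
  rw [_root_.abs_le] at h3 h4 h5 ⊢
  constructor <;> linarith

theorem one_sub (hf : CutoffBound f z B) (h0 : 0 ≤ f z) : CutoffBound (fun w => 1 - f w) z B := by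
  have hf2 : ContDiffAt ℝ 2 f z := hf.contDiffAt.of_le (by norm_num)
  have hfd := hf2.differentiableAt (by norm_num)
  have e : (fun w => 1 - f w) = fun w => 1 + -1 * f w := by
    funext w
    ring
  have h1 := (_root_.abs_le.1 hf.abs_le).2
  have hc : ContDiffAt ℝ 2 (fun w => -1 * f w) z := contDiffAt_const.mul hf2
  refine ⟨contDiffAt_const.sub hf.contDiffAt, _root_.abs_le.2 ⟨by linarith, by linarith⟩, ?_, ?_, ?_⟩
  · rw [e, partialRe_add (differentiableAt_const _) (hfd.const_mul _), partialRe_const_mul hfd]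
    simpa using hf.re_le
  · rw [e, partialIm_add (differentiableAt_const _) (hfd.const_mul _), partialIm_const_mul hfd]
    simpa using hf.im_le
  · rw [e, planeLaplacian_add contDiffAt_const hc, planeLaplacian_const_mul hf2,
      show planeLaplacian (fun _ => 1) z = 0 by simp [planeLaplacian], zero_add, neg_one_mul, abs_neg]
    exact hf.lap_le

end CutoffBound

theorem exists_smoothTransition_bound : ∃ A : ℝ, 1 ≤ A ∧ ∀ s,
    |deriv Real.smoothTransition s| ≤ A ∧ |deriv (deriv Real.smoothTransition) s| ≤ A := by
  have h1 : ContDiff ℝ 1 (deriv Real.smoothTransition) :=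
    ((Real.smoothTransition.contDiff (n := 2)).iterate_deriv' 1 1)
  have hz : HasCompactSupport (deriv Real.smoothTransition) := by
    refine HasCompactSupport.intro (isCompact_Icc (a := (0 : ℝ)) (b := 1)) fun s hs => ?_
    rw [mem_Icc, not_and_or, not_le, not_le] at hs
    have : ∃ b : ℝ, Real.smoothTransition =ᶠ[𝓝 s] fun _ => b := by
      rcases hs with h | h
      · exact ⟨0, by
          filter_upwards [gt_mem_nhds h] with x hx using Real.smoothTransition.zero_of_nonpos hx.le⟩
      · exact ⟨1, by
          filter_upwards [lt_mem_nhds h] with x hx using Real.smoothTransition.one_of_one_le hx.le⟩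
    obtain ⟨b, hb⟩ := this
    rw [hb.deriv_eq, deriv_const]
  obtain ⟨A₁, hA₁⟩ := h1.continuous.bounded_above_of_compact_support hz
  obtain ⟨A₂, hA₂⟩ := (h1.continuous_deriv le_rfl).bounded_above_of_compact_support hz.deriv
  refine ⟨max 1 (max A₁ A₂), le_max_left _ _, fun s => ⟨?_, ?_⟩⟩
  · exact (hA₁ s).trans ((le_max_left _ _).trans (le_max_right _ _))
  · exact (hA₂ s).trans ((le_max_right _ _).trans (le_max_right _ _))

/-- A smooth radial step around `b`. -/
def radialStep (b : ℂ) (α s₀ : ℝ) (z : ℂ) : ℝ :=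
  Real.smoothTransition (α * (‖z - b‖ ^ 2 - s₀))

section

variable {b z : ℂ} {α s₀ : ℝ}

theorem radialStep_nonneg : 0 ≤ radialStep b α s₀ z := Real.smoothTransition.nonneg _

theorem radialStep_le_one : radialStep b α s₀ z ≤ 1 := Real.smoothTransition.le_one _

theorem radialStep_eq_zero (hα : 0 ≤ α) (h : ‖z - b‖ ^ 2 ≤ s₀) : radialStep b α s₀ z = 0 :=
  Real.smoothTransition.zero_of_nonpos (mul_nonpos_of_nonneg_of_nonpos hα (by linarith))

theorem radialStep_eq_one (h : 1 ≤ α * (‖z - b‖ ^ 2 - s₀)) : radialStep b α s₀ z = 1 :=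
  Real.smoothTransition.one_of_one_le h

theorem continuous_norm_sub_sq (b : ℂ) : Continuous fun w : ℂ => ‖w - b‖ ^ 2 := by fun_prop

theorem radialStep_eventuallyEq_zero (hα : 0 ≤ α) (h : ‖z - b‖ ^ 2 < s₀) :
    radialStep b α s₀ =ᶠ[𝓝 z] fun _ => 0 := by
  filter_upwards [(continuous_norm_sub_sq b).continuousAt.eventually (gt_mem_nhds h)] with w hw
    using radialStep_eq_zero hα hw.le

theorem radialStep_eventuallyEq_one (h : 1 < α * (‖z - b‖ ^ 2 - s₀)) :
    radialStep b α s₀ =ᶠ[𝓝 z] fun _ => 1 := by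
  have hc : Continuous fun w : ℂ => α * (‖w - b‖ ^ 2 - s₀) := by fun_prop
  filter_upwards [hc.continuousAt.eventually (lt_mem_nhds h)] with w hw
    using radialStep_eq_one hw.le

theorem contDiffAt_radialStep : ContDiffAt ℝ 3 (radialStep b α s₀) z := by
  refine contDiffAt_radial (g := fun s => Real.smoothTransition (α * (s - s₀))) ?_
  have h : ContDiff ℝ 3 fun s : ℝ => α * (s - s₀) := by fun_prop
  exact ((Real.smoothTransition.contDiff (n := 3)).comp h).contDiffAt

theorem cutoffBound_radialStep {A D : ℝ} (hA : 1 ≤ A)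
    (hA' : ∀ s, |deriv Real.smoothTransition s| ≤ A ∧ |deriv (deriv Real.smoothTransition) s| ≤ A)
    (hα : 0 ≤ α) (hD : 0 ≤ D) (h : 4 * α + 4 * ‖z - b‖ ^ 2 * α ^ 2 ≤ D ^ 2) :
    CutoffBound (radialStep b α s₀) z (D * A) := by
  have hd1 : ∀ s, HasDerivAt Real.smoothTransition (deriv Real.smoothTransition s) s := fun s =>
    ((Real.smoothTransition.contDiff (n := 1)).differentiable (by norm_num) s).hasDerivAt
  have hd2 : ∀ s, HasDerivAt (deriv Real.smoothTransition)
      (deriv (deriv Real.smoothTransition) s) s := fun s =>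
    (((Real.smoothTransition.contDiff (n := 2)).iterate_deriv' 1 1).differentiable
      (by norm_num) s).hasDerivAt
  have hlin : ∀ s, HasDerivAt (fun s : ℝ => α * (s - s₀)) α s := fun s => by
    simpa using ((hasDerivAt_id s).sub_const s₀).const_mul α
  have hg : ∀ s, HasDerivAt (fun s => Real.smoothTransition (α * (s - s₀)))
      (deriv Real.smoothTransition (α * (s - s₀)) * α) s := fun s =>
    HasDerivAt.comp s (hd1 _) (hlin s)
  have hg1 : ∀ s, HasDerivAt (fun s => deriv Real.smoothTransition (α * (s - s₀)) * α)
      (deriv (deriv Real.smoothTransition) (α * (s - s₀)) * α * α) s := fun s =>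
    (HasDerivAt.comp s (hd2 _) (hlin s)).mul_const α
  have hA0 : 0 ≤ A := by linarith
  have hsmall : 2 * ‖z - b‖ * α ≤ D := by
    refine le_of_sq_le_sq ?_ hD
    nlinarith
  have hpart : ∀ x : ℝ, |x| ≤ ‖z - b‖ →
      |2 * x * (deriv Real.smoothTransition (α * (‖z - b‖ ^ 2 - s₀)) * α)| ≤ D * A := fun x hx => by
    rw [abs_mul, abs_mul, abs_mul, abs_two, abs_of_nonneg hα]
    calc 2 * |x| * (|deriv Real.smoothTransition (α * (‖z - b‖ ^ 2 - s₀))| * α)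
        ≤ 2 * ‖z - b‖ * (A * α) := by gcongr; exact (hA' _).1
      _ = 2 * ‖z - b‖ * α * A := by ring
      _ ≤ D * A := by gcongr
  refine ⟨contDiffAt_radialStep, ?_, ?_, ?_, ?_⟩
  · rw [abs_of_nonneg radialStep_nonneg]
    exact radialStep_le_one
  · refine le_of_eq_of_le (congrArg _ (partialRe_radial (hg _))) (hpart _ (Complex.abs_re_le_norm _))
  · refine le_of_eq_of_le (congrArg _ (partialIm_radial (hg _))) (hpart _ (Complex.abs_im_le_norm _))
  · refine le_of_eq_of_le (congrArg _ (planeLaplacian_radial (Eventually.of_forall hg) (hg1 _))) ?_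
    set p := deriv Real.smoothTransition (α * (‖z - b‖ ^ 2 - s₀))
    set q := deriv (deriv Real.smoothTransition) (α * (‖z - b‖ ^ 2 - s₀))
    have hp : |p| ≤ A := (hA' _).1
    have hq : |q| ≤ A := (hA' _).2
    calc |4 * (p * α) + 4 * ‖z - b‖ ^ 2 * (q * α * α)|
        ≤ |4 * (p * α)| + |4 * ‖z - b‖ ^ 2 * (q * α * α)| := abs_add_le _ _
      _ = 4 * (|p| * α) + 4 * ‖z - b‖ ^ 2 * (|q| * α * α) := by
        simp only [abs_mul, abs_of_nonneg hα, abs_of_nonneg (sq_nonneg ‖z - b‖), Nat.abs_ofNat]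
      _ ≤ 4 * (A * α) + 4 * ‖z - b‖ ^ 2 * (A * α * α) := by gcongr
      _ = (4 * α + 4 * ‖z - b‖ ^ 2 * α ^ 2) * A := by ring
      _ ≤ D ^ 2 * A := by gcongr
      _ ≤ D ^ 2 * A ^ 2 := by gcongr; nlinarith
      _ = (D * A) ^ 2 := by ring

end

/-- A cutoff function vanishing near the disks `closedBall (c i) 2`, `i ∈ J`. -/
def diskCutoff {ι : Type} (c : ι → ℂ) (J : Finset ι) (z : ℂ) : ℝ :=
  ∏ i ∈ J, radialStep (c i) 1 (25 / 4) z

/-- A cutoff function vanishing near `0`, equal to one off `ball 0 ρ`. -/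
def holeCutoff (ρ : ℝ) : ℂ → ℝ := radialStep 0 (2 / ρ ^ 2) (ρ ^ 2 / 2)

/-- A cutoff function supported in a ball slightly smaller than `ball 0 R`. -/
def outerCutoff (R : ℝ) (z : ℂ) : ℝ := 1 - radialStep 0 (200 / R ^ 2) (197 / 200 * R ^ 2) z

/-- The product of the three cutoff functions. -/
def totalCutoff {ι : Type} (c : ι → ℂ) (J : Finset ι) (ρ R : ℝ) (z : ℂ) : ℝ :=
  diskCutoff c J z * (holeCutoff ρ z * outerCutoff R z)

section

variable {ι : Type} {c : ι → ℂ} {J : Finset ι} {z : ℂ} {ρ R A : ℝ}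

theorem diskCutoff_eventuallyEq_one (h : ∀ i ∈ J, 29 / 4 < ‖z - c i‖ ^ 2) :
    diskCutoff c J =ᶠ[𝓝 z] fun _ => 1 := by
  have h1 : ∀ᶠ w in 𝓝 z, ∀ i ∈ J, radialStep (c i) 1 (25 / 4) w = 1 :=
    (eventually_all_finset J).2 fun i hi =>
      radialStep_eventuallyEq_one (by linarith [h i hi])
  filter_upwards [h1] with w hw using Finset.prod_eq_one hw

theorem diskCutoff_eventuallyEq_zero {i : ι} (hi : i ∈ J) (h : ‖z - c i‖ ^ 2 < 25 / 4) :
    diskCutoff c J =ᶠ[𝓝 z] fun _ => 0 := by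
  filter_upwards [radialStep_eventuallyEq_zero zero_le_one h] with w hw
    using Finset.prod_eq_zero hi hw

theorem diskCutoff_eventuallyEq_radialStep (hsep : ∀ i j, i ≠ j → 100 ≤ dist (c i) (c j)) {i : ι}
    (hi : i ∈ J) (h : ‖z - c i‖ ^ 2 ≤ 29 / 4) :
    diskCutoff c J =ᶠ[𝓝 z] radialStep (c i) 1 (25 / 4) := by
  have h1 : ‖z - c i‖ < 10 := by nlinarith
  have h2 : ∀ᶠ w in 𝓝 z, ‖w - c i‖ < 10 :=
    (show Continuous fun w => ‖w - c i‖ by fun_prop).continuousAt.eventually (gt_mem_nhds h1)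
  filter_upwards [h2] with w hw
  refine Finset.prod_eq_single_of_mem i hi fun j _ hji => radialStep_eq_one ?_
  have h3 := le_dist_of_dist_le hsep hji (z := w) (by rw [dist_eq_norm]; exact hw.le)
  rw [dist_eq_norm] at h3
  nlinarith

theorem diskCutoff_eq_one (h : ∀ i ∈ J, 29 / 4 ≤ ‖z - c i‖ ^ 2) : diskCutoff c J z = 1 :=
  Finset.prod_eq_one fun i hi => radialStep_eq_one (by linarith [h i hi])

theorem cutoffBound_diskCutoff (hA : 1 ≤ A)
    (hA' : ∀ s, |deriv Real.smoothTransition s| ≤ A ∧ |deriv (deriv Real.smoothTransition) s| ≤ A)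
    (hsep : ∀ i j, i ≠ j → 100 ≤ dist (c i) (c j)) : CutoffBound (diskCutoff c J) z (6 * A) := by
  by_cases h : ∀ i ∈ J, 29 / 4 < ‖z - c i‖ ^ 2
  · exact (CutoffBound.const (by simp) (by positivity)).congr (diskCutoff_eventuallyEq_one h)
  · push Not at h
    obtain ⟨i, hi, h⟩ := h
    exact (cutoffBound_radialStep hA hA' zero_le_one (by norm_num) (by linarith)).congr
      (diskCutoff_eventuallyEq_radialStep hsep hi h)

theorem holeCutoff_eventuallyEq_one (hρ : 0 < ρ) (h : ρ < ‖z‖) :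
    holeCutoff ρ =ᶠ[𝓝 z] fun _ => 1 := by
  refine radialStep_eventuallyEq_one ?_
  rw [sub_zero, div_mul_eq_mul_div, one_lt_div (by positivity)]
  nlinarith

theorem holeCutoff_eq_one (hρ : 0 < ρ) (h : ρ ≤ ‖z‖) : holeCutoff ρ z = 1 := by
  refine radialStep_eq_one ?_
  rw [sub_zero, div_mul_eq_mul_div, one_le_div (by positivity)]
  nlinarith

theorem cutoffBound_holeCutoff (hA : 1 ≤ A)
    (hA' : ∀ s, |deriv Real.smoothTransition s| ≤ A ∧ |deriv (deriv Real.smoothTransition) s| ≤ A)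
    (hρ : 0 < ρ) : CutoffBound (holeCutoff ρ) z (5 / ρ * A) := by
  rcases lt_or_ge ρ ‖z‖ with h | h
  · exact (CutoffBound.const (by simp) (by positivity)).congr (holeCutoff_eventuallyEq_one hρ h)
  · refine cutoffBound_radialStep hA hA' (by positivity) (by positivity) ?_
    have h1 : ‖z - 0‖ ^ 2 ≤ ρ ^ 2 := by rw [sub_zero]; gcongr
    calc 4 * (2 / ρ ^ 2) + 4 * ‖z - 0‖ ^ 2 * (2 / ρ ^ 2) ^ 2
        ≤ 4 * (2 / ρ ^ 2) + 4 * ρ ^ 2 * (2 / ρ ^ 2) ^ 2 := by gcongr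
      _ = 24 / ρ ^ 2 := by field_simp; norm_num
      _ ≤ 25 / ρ ^ 2 := by gcongr; norm_num
      _ = (5 / ρ) ^ 2 := by rw [div_pow]; norm_num

theorem outerCutoff_eventuallyEq_one (hR : 0 < R) (h : ‖z‖ ^ 2 < 197 / 200 * R ^ 2) :
    outerCutoff R =ᶠ[𝓝 z] fun _ => 1 := by
  filter_upwards [radialStep_eventuallyEq_zero (b := 0) (α := 200 / R ^ 2)
    (s₀ := 197 / 200 * R ^ 2) (by positivity) (by simpa using h)] with w hw
  rw [outerCutoff, hw, sub_zero]

theorem outerCutoff_eventuallyEq_zero (hR : 0 < R) (h : 99 / 100 * R ^ 2 < ‖z‖ ^ 2) :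
    outerCutoff R =ᶠ[𝓝 z] fun _ => 0 := by
  have h1 : 1 < 200 / R ^ 2 * (‖z - 0‖ ^ 2 - 197 / 200 * R ^ 2) := by
    rw [sub_zero, div_mul_eq_mul_div, one_lt_div (by positivity)]
    linarith
  filter_upwards [radialStep_eventuallyEq_one h1] with w hw
  rw [outerCutoff, hw, sub_self]

theorem cutoffBound_outerCutoff (hA : 1 ≤ A)
    (hA' : ∀ s, |deriv Real.smoothTransition s| ≤ A ∧ |deriv (deriv Real.smoothTransition) s| ≤ A)
    (hR : 10 ^ 4 < R) (hz : ‖z‖ ≤ R) : CutoffBound (outerCutoff R) z (1 * A) := by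
  have hR0 : 0 < R := by linarith
  refine CutoffBound.one_sub (cutoffBound_radialStep hA hA' (by positivity) zero_le_one ?_)
    radialStep_nonneg
  have h1 : ‖z - 0‖ ^ 2 ≤ R ^ 2 := by rw [sub_zero]; gcongr
  calc 4 * (200 / R ^ 2) + 4 * ‖z - 0‖ ^ 2 * (200 / R ^ 2) ^ 2
      ≤ 4 * (200 / R ^ 2) + 4 * R ^ 2 * (200 / R ^ 2) ^ 2 := by gcongr
    _ = 160800 / R ^ 2 := by field_simp; norm_num
    _ ≤ 1 ^ 2 := by
      rw [div_le_iff₀ (by positivity)]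
      nlinarith

theorem totalCutoff_eventuallyEq_zero (hρ : 0 < ρ) (hR : 0 < R)
    (h : ‖z‖ ^ 2 < ρ ^ 2 / 2 ∨ 99 / 100 * R ^ 2 < ‖z‖ ^ 2 ∨ ∃ i ∈ J, ‖z - c i‖ ^ 2 < 25 / 4) :
    totalCutoff c J ρ R =ᶠ[𝓝 z] fun _ => 0 := by
  rcases h with h | h | ⟨i, hi, h⟩
  · filter_upwards [radialStep_eventuallyEq_zero (b := 0) (α := 2 / ρ ^ 2) (s₀ := ρ ^ 2 / 2)
      (by positivity) (by simpa using h)] with w hw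
    rw [totalCutoff, holeCutoff, hw, zero_mul, mul_zero]
  · filter_upwards [outerCutoff_eventuallyEq_zero hR h] with w hw
    rw [totalCutoff, hw, mul_zero, mul_zero]
  · filter_upwards [diskCutoff_eventuallyEq_zero hi h] with w hw
    rw [totalCutoff, hw, zero_mul]

theorem cutoffBound_totalCutoff (hA : 1 ≤ A)
    (hA' : ∀ s, |deriv Real.smoothTransition s| ≤ A ∧ |deriv (deriv Real.smoothTransition) s| ≤ A)
    (hsep : ∀ i j, i ≠ j → 100 ≤ dist (c i) (c j)) (hρ : 0 < ρ) (hR : 10 ^ 4 < R) (hz : ‖z‖ ≤ R) :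
    CutoffBound (totalCutoff c J ρ R) z
      (2 * (6 * A + 2 * (5 / ρ * A + 1 * A))) :=
  (cutoffBound_diskCutoff hA hA' hsep).mul
    ((cutoffBound_holeCutoff hA hA' hρ).mul (cutoffBound_outerCutoff hA hA' hR hz))

end

namespace PerforatedHarmonic

variable {ι : Type} {c : ι → ℂ} {J : Finset ι} {z : ℂ} {ρ R A : ℝ} {v : ℂ → ℝ}

theorem le_dist_of_notMem (hJ : ∀ i, i ∈ J ↔ ‖c i‖ ≤ R) (hR : 10 ^ 4 < R)
    (hz : ‖z‖ ^ 2 ≤ 99 / 100 * R ^ 2) (h : ∀ i ∈ J, 25 / 4 ≤ ‖z - c i‖ ^ 2) (i : ι) :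
    5 / 2 ≤ dist z (c i) := by
  rw [dist_eq_norm]
  by_cases hi : i ∈ J
  · nlinarith [h i hi, norm_nonneg (z - c i)]
  · rw [hJ, not_le] at hi
    have h1 : ‖z‖ ≤ 995 / 1000 * R := by
      refine le_of_sq_le_sq ?_ (by linarith)
      nlinarith
    have h2 := norm_sub_norm_le (c i) z
    rw [norm_sub_rev] at h2
    linarith

theorem harmonicAt_of_cutoff (hv : PerforatedHarmonic c R v) (hJ : ∀ i, i ∈ J ↔ ‖c i‖ ≤ R)
    (hR : 10 ^ 4 < R) (hz : ‖z‖ ^ 2 ≤ 99 / 100 * R ^ 2) (h : ∀ i ∈ J, 25 / 4 ≤ ‖z - c i‖ ^ 2) :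
    HarmonicAt v z := by
  refine hv.harm z ?_ fun i => by linarith [le_dist_of_notMem hJ hR hz h i]
  refine lt_of_pow_lt_pow_left₀ 2 (by linarith) ?_
  nlinarith

theorem contDiff_mul_totalCutoff (hv : PerforatedHarmonic c R v) (hJ : ∀ i, i ∈ J ↔ ‖c i‖ ≤ R)
    (hR : 10 ^ 4 < R) (hρ : 0 < ρ) : ContDiff ℝ 3 fun w => v w * totalCutoff c J ρ R w := by
  obtain ⟨A, hA, hA'⟩ := exists_smoothTransition_bound
  rw [contDiff_iff_contDiffAt]
  intro z
  by_cases h : ‖z‖ ^ 2 < ρ ^ 2 / 2 ∨ 99 / 100 * R ^ 2 < ‖z‖ ^ 2 ∨ ∃ i ∈ J, ‖z - c i‖ ^ 2 < 25 / 4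
  · refine (contDiffAt_const (c := (0 : ℝ))).congr_of_eventuallyEq ?_
    filter_upwards [totalCutoff_eventuallyEq_zero hρ (by linarith) h] with w hw
    rw [hw, mul_zero]
  · push Not at h
    have h1 : ‖z‖ ≤ R := le_of_sq_le_sq (by nlinarith [h.2.1]) (by linarith)
    exact (HarmonicAt.analyticAt (hv.harmonicAt_of_cutoff hJ hR h.2.1 h.2.2)).contDiffAt.mul
      (cutoffBound_totalCutoff hA hA' hv.sep hρ hR h1).contDiffAt

theorem tsupport_mul_totalCutoff_subset (hR : 0 < R) (hρ : 0 < ρ) :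
    tsupport (fun w => v w * totalCutoff c J ρ R w) ⊆
      {z | ρ ^ 2 / 2 ≤ ‖z‖ ^ 2 ∧ ‖z‖ ≤ R ∧ ∀ i ∈ J, 2 ≤ ‖z - c i‖} := by
  intro z hz
  by_contra h
  refine (notMem_tsupport_iff_eventuallyEq.2 ?_) hz
  have h1 : ‖z‖ ^ 2 < ρ ^ 2 / 2 ∨ 99 / 100 * R ^ 2 < ‖z‖ ^ 2 ∨
      ∃ i ∈ J, ‖z - c i‖ ^ 2 < 25 / 4 := by
    by_contra h2
    push Not at h2
    refine h ⟨h2.1, le_of_sq_le_sq (by nlinarith [h2.2.1]) hR.le, fun i hi => ?_⟩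
    nlinarith [h2.2.2 i hi, norm_nonneg (z - c i)]
  filter_upwards [totalCutoff_eventuallyEq_zero hρ hR h1] with w hw
  rw [hw, mul_zero]
  rfl

/-- A point at distance `2.88` from the center `b`, closer to the origin. -/
def nearPoint (b : ℂ) : ℂ := ((1 - 72 / 25 / ‖b‖ : ℝ) : ℂ) * b

theorem norm_nearPoint_sub {b : ℂ} (hb : 3 < ‖b‖) : ‖nearPoint b - b‖ = 72 / 25 := by
  have : nearPoint b - b = ((-(72 / 25 / ‖b‖) : ℝ) : ℂ) * b := by
    rw [nearPoint]
    push_cast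
    ring
  have hb0 : ‖b‖ ≠ 0 := by linarith
  rw [this, norm_mul, Complex.norm_real, Real.norm_eq_abs, abs_neg, abs_of_pos (by positivity)]
  field_simp

theorem norm_nearPoint {b : ℂ} (hb : 3 < ‖b‖) : ‖nearPoint b‖ = ‖b‖ - 72 / 25 := by
  have hb0 : ‖b‖ ≠ 0 := by linarith
  have h1 : 72 / 25 / ‖b‖ ≤ 1 := by
    rw [div_le_one (by linarith)]
    linarith
  rw [nearPoint, norm_mul, Complex.norm_real, Real.norm_eq_abs, abs_of_nonneg (by linarith)]
  field_simp

theorem planeLaplacian_cutoff_cases (hv : PerforatedHarmonic c R v)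
    (hJ : ∀ i, i ∈ J ↔ ‖c i‖ ≤ R) (hR : 10 ^ 4 < R) {r : ℝ} (hr : 0 < r) (hrR : r ≤ R / 4)
    {m M : ℝ} (hm : BoundedOff c v r m) (hM : BoundedOff c v R M) (hρ : ρ = r / 1000) (hA : 1 ≤ A)
    (hA' : ∀ s, |deriv Real.smoothTransition s| ≤ A ∧ |deriv (deriv Real.smoothTransition) s| ≤ A)
    (z : ℂ) :
    planeLaplacian (fun w => v w * totalCutoff c J ρ R w) z = 0 ∨
    (ρ ^ 2 / 2 ≤ ‖z‖ ^ 2 ∧ ‖z‖ ≤ R ∧ |planeLaplacian (fun w => v w * totalCutoff c J ρ R w) z| ≤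
      1100 * A ^ 2 * Real.exp 56 * ((1 + 1 / ρ) ^ 2 * m)) ∨
    (197 / 200 * R ^ 2 ≤ ‖z‖ ^ 2 ∧ ‖z‖ ≤ R ∧
      |planeLaplacian (fun w => v w * totalCutoff c J ρ R w) z| ≤
      1100 * A ^ 2 * Real.exp 56 * M) ∨
    (∃ i ∈ J, ρ + 147 / 50 ≤ ‖c i‖ ∧ (‖c i‖ - 27 / 10) ^ 2 ≤ 197 / 200 * R ^ 2 ∧ ‖z - c i‖ < 3 ∧
      ‖c i‖ - 27 / 10 ≤ ‖z‖ ∧ |planeLaplacian (fun w => v w * totalCutoff c J ρ R w) z| ≤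
      1100 * A ^ 2 * Real.exp 56 * |v (nearPoint (c i))|) := by
  have hρ0 : 0 < ρ := by linarith
  have hR0 : 0 < R := by linarith
  rw [or_iff_not_imp_left]
  intro hnonzero
  by_cases h : ‖z‖ ^ 2 < ρ ^ 2 / 2 ∨ 99 / 100 * R ^ 2 < ‖z‖ ^ 2 ∨ ∃ i ∈ J, ‖z - c i‖ ^ 2 < 25 / 4
  · refine absurd ?_ hnonzero
    have : (fun w => v w * totalCutoff c J ρ R w) =ᶠ[𝓝 z] fun _ => 0 := by
      filter_upwards [totalCutoff_eventuallyEq_zero hρ0 hR0 h] with w hw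
      rw [hw, mul_zero]
    rw [this.planeLaplacian.self_of_nhds]
    simp [planeLaplacian]
  push Not at h
  obtain ⟨h1, h2, h3⟩ := h
  have hz : ‖z‖ ≤ R := le_of_sq_le_sq (by nlinarith) hR0.le
  have hz' : ‖z‖ ≤ 995 / 1000 * R := le_of_sq_le_sq (by nlinarith) (by linarith)
  have hdist := le_dist_of_notMem hJ hR h2 h3
  have hharm := hv.harmonicAt_of_cutoff hJ hR h2 h3
  by_cases hin : ‖z‖ ≤ if r < 60 then r / 1000 else r / 1000 + 6
  · left
    obtain ⟨hb1, hb2⟩ := hv.inner_bounds (by linarith) hr hrR hm hin hdist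
    refine ⟨h1, hz, ?_⟩
    have hB := (cutoffBound_totalCutoff (J := J) hA hA' hv.sep hρ0 hR hz).abs_planeLaplacian_mul_le
      hharm hb2
    refine hB.trans ?_
    rw [← hρ]
    have hm0 : 0 ≤ Real.exp 56 * m := (abs_nonneg _).trans hb1
    have hX : 1 ≤ 1 + 1 / ρ := by linarith [show 0 < 1 / ρ by positivity]
    rw [show 5 / ρ = 5 * (1 + 1 / ρ) - 5 by ring]
    generalize 1 + 1 / ρ = X at hX ⊢
    have h5 : 2 * (6 * A + 2 * ((5 * X - 5) * A + 1 * A)) ≤ 20 * (A * X) := by nlinarith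
    have h6 : 0 ≤ 2 * (6 * A + 2 * ((5 * X - 5) * A + 1 * A)) := by nlinarith
    have hAX : A * X ^ 2 ≤ A ^ 2 * X ^ 2 := by gcongr; nlinarith
    calc _ ≤ Real.exp 56 * m * (20 * (A * X)) ^ 2
          + 4 * (8 * X * (Real.exp 56 * m)) * (20 * (A * X)) := by gcongr
      _ = Real.exp 56 * m * (400 * (A ^ 2 * X ^ 2) + 640 * (A * X ^ 2)) := by ring
      _ ≤ Real.exp 56 * m * (1100 * (A ^ 2 * X ^ 2)) := by
        refine mul_le_mul_of_nonneg_left ?_ hm0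
        nlinarith [sq_nonneg (A * X)]
      _ = 1100 * A ^ 2 * Real.exp 56 * (X ^ 2 * m) := by ring
  right
  have hin' : ρ < ‖z‖ := by
    rw [not_le] at hin
    refine lt_of_le_of_lt ?_ hin
    split_ifs <;> linarith
  have hAA : A ≤ A ^ 2 := by nlinarith
  by_cases hout : 197 / 200 * R ^ 2 ≤ ‖z‖ ^ 2
  · left
    refine ⟨hout, hz, ?_⟩
    have hb1 := hv.abs_le_of_boundedOff le_rfl hM (z := z) (by linarith)
      fun i => by linarith [hdist i]
    have hb2 := hv.norm_fderiv_le_of_boundedOff le_rfl hM (z := z) (by linarith) hdist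
    have hM0 : 0 ≤ Real.exp 56 * M := (abs_nonneg _).trans hb1
    have hcong : (fun w => v w * totalCutoff c J ρ R w) =ᶠ[𝓝 z]
        fun w => v w * (diskCutoff c J w * outerCutoff R w) := by
      filter_upwards [holeCutoff_eventuallyEq_one hρ0 hin'] with w hw
      rw [totalCutoff, hw, one_mul]
    rw [hcong.planeLaplacian.self_of_nhds]
    have hB := ((cutoffBound_diskCutoff (J := J) hA hA' hv.sep).mul
      (cutoffBound_outerCutoff hA hA' hR hz)).abs_planeLaplacian_mul_le hharm hb2
    refine hB.trans ?_
    calc _ ≤ Real.exp 56 * M * (2 * (6 * A + 1 * A)) ^ 2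
          + 4 * (8 * (Real.exp 56 * M)) * (2 * (6 * A + 1 * A)) := by gcongr
      _ = Real.exp 56 * M * (196 * A ^ 2 + 448 * A) := by ring
      _ ≤ Real.exp 56 * M * (1100 * A ^ 2) := by
        refine mul_le_mul_of_nonneg_left ?_ hM0
        nlinarith
      _ = 1100 * A ^ 2 * Real.exp 56 * M := by ring
  rw [not_le] at hout
  have hcong : (fun w => v w * totalCutoff c J ρ R w) =ᶠ[𝓝 z] fun w => v w * diskCutoff c J w := by
    filter_upwards [holeCutoff_eventuallyEq_one hρ0 hin', outerCutoff_eventuallyEq_one hR0 hout]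
      with w hw hw'
    rw [totalCutoff, hw, hw', one_mul, mul_one]
  rw [hcong.planeLaplacian.self_of_nhds]
  by_cases hnear : ∀ i ∈ J, 29 / 4 < ‖z - c i‖ ^ 2
  · refine absurd ?_ hnonzero
    have h4 : (fun w => v w * totalCutoff c J ρ R w) =ᶠ[𝓝 z] v := by
      filter_upwards [hcong, diskCutoff_eventuallyEq_one hnear] with w hw hw'
      rw [hw, hw', mul_one]
    rw [h4.planeLaplacian.self_of_nhds, planeLaplacian_eq_laplacian hharm.1]
    exact hharm.2.self_of_nhds
  push Not at hnear
  obtain ⟨i, hi, hi2⟩ := hnear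
  right
  have hd1 : 5 / 2 ≤ ‖z - c i‖ := dist_eq_norm z (c i) ▸ hdist i
  have hd2 : ‖z - c i‖ < 27 / 10 := by nlinarith
  have hc3 := hv.three_lt i
  have hle1 := norm_sub_norm_le (c i) z
  have hle2 := norm_sub_norm_le z (c i)
  rw [norm_sub_rev] at hle1
  have hsq : (‖c i‖ - 27 / 10) ^ 2 ≤ ‖z‖ ^ 2 := pow_le_pow_left₀ (by linarith) (by linarith) 2
  have hcR : ‖c i‖ + 5 ≤ R := by
    have : ‖z‖ ≤ 9925 / 10000 * R := le_of_sq_le_sq (by nlinarith) (by linarith)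
    linarith
  have hz2 : 2 ≤ dist z (c i) := by linarith [hdist i]
  have hz4 : dist z (c i) ≤ 4 := by rw [dist_eq_norm]; linarith
  have hq : dist (nearPoint (c i)) (c i) = 72 / 25 := by
    rw [dist_eq_norm, norm_nearPoint_sub hc3]
  have hb1 := hv.abs_le_exp_mul hcR hz2 hz4 (w := nearPoint (c i)) (by rw [hq]; norm_num)
    (by rw [hq]; norm_num)
  have hb2 := hv.norm_fderiv_le_abs hcR hz2 hz4
  refine ⟨i, hi, ?_, by linarith, by linarith, by linarith, ?_⟩
  · rw [not_le] at hin
    split_ifs at hin <;> linarith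
  have hB := (cutoffBound_diskCutoff (J := J) hA hA' hv.sep).abs_planeLaplacian_mul_le hharm hb2
  refine hB.trans ?_
  have hU : 0 ≤ Real.exp 56 * |v (nearPoint (c i))| := by positivity
  calc |v z| * (6 * A) ^ 2 + 4 * (2 * |v z|) * (6 * A) = |v z| * (36 * A ^ 2 + 48 * A) := by ring
    _ ≤ Real.exp 56 * |v (nearPoint (c i))| * (1100 * A ^ 2) := by
      refine mul_le_mul hb1 ?_ (by positivity) hU
      nlinarith
    _ = 1100 * A ^ 2 * Real.exp 56 * |v (nearPoint (c i))| := by ring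

end PerforatedHarmonic

theorem integrable_indicator_ball_const (x : ℂ) (ρ b : ℝ) :
    Integrable ((ball x ρ).indicator fun _ => b) :=
  (integrableOn_const measure_ball_lt_top.ne).integrable_indicator measurableSet_ball

theorem integral_indicator_ball_const (x : ℂ) {ρ : ℝ} (hρ : 0 ≤ ρ) (b : ℝ) :
    ∫ z, (ball x ρ).indicator (fun _ => b) z = b * (Real.pi * ρ ^ 2) := by
  rw [integral_indicator measurableSet_ball, setIntegral_const, measureReal_ball_complex x hρ,
    smul_eq_mul, mul_comm]

theorem integral_le_of_le_sum_indicator_ball {ι : Type} {g : ℂ → ℝ} (hg : Integrable g)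
    {F : Finset ι} {x : ι → ℂ} {b₀ ρ₀ ρ : ℝ} (hρ₀ : 0 ≤ ρ₀) (hρ : 0 ≤ ρ) {b : ι → ℝ}
    (h : ∀ z, g z ≤ (ball 0 ρ₀).indicator (fun _ => b₀) z +
      ∑ i ∈ F, (ball (x i) ρ).indicator (fun _ => b i) z) :
    ∫ z, g z ≤ b₀ * (Real.pi * ρ₀ ^ 2) + (∑ i ∈ F, b i) * (Real.pi * ρ ^ 2) := by
  have h1 := integrable_indicator_ball_const 0 ρ₀ b₀
  have h2 : Integrable fun z => ∑ i ∈ F, (ball (x i) ρ).indicator (fun _ => b i) z :=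
    integrable_finsetSum _ fun i _ => integrable_indicator_ball_const (x i) ρ (b i)
  calc ∫ z, g z ≤ ∫ z, ((ball 0 ρ₀).indicator (fun _ => b₀) z +
      ∑ i ∈ F, (ball (x i) ρ).indicator (fun _ => b i) z) :=
        integral_mono hg (h1.add h2) h
    _ = _ := by
        rw [integral_add h1 h2, integral_finsetSum _ fun i _ =>
          integrable_indicator_ball_const (x i) ρ (b i), integral_indicator_ball_const 0 hρ₀,
          Finset.sum_mul]
        simp only [integral_indicator_ball_const _ hρ]

/-- The integrand of the left-hand side of the Carleman inequality for `v * totalCutoff`. -/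
def carlemanIntegrand {ι : Type} (c : ι → ℂ) (J : Finset ι) (t ρ R : ℝ) (v : ℂ → ℝ) (z : ℂ) : ℝ :=
  (v z * totalCutoff c J ρ R z) ^ 2 *
    (carlemanDensity c J R z * Real.exp (carlemanWeight c J t R z))

theorem sq_mul_exp_carlemanWeight_le {ι : Type} {c : ι → ℂ} {J : Finset ι} {t R K : ℝ} {z : ℂ}
    (hK : ∑ i ∈ J, ((1 + ‖z - c i‖ ^ 2) ^ 2)⁻¹ ≤ K) (ht : 0 ≤ t) (hz : ‖z‖ ≤ R) {s D Y : ℝ}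
    (hs : 0 < s) (hsz : s ≤ ‖z‖ ^ 2) (hD : |D| ≤ Y) :
    D ^ 2 * Real.exp (carlemanWeight c J t R z) ≤ Y ^ 2 * (Real.exp (K + 1) * s ^ (-t)) := by
  have hz0 : z ≠ 0 := by
    rintro rfl
    simp at hsz
    linarith
  refine mul_le_mul (sq_le_sq' (abs_le.1 hD).1 (abs_le.1 hD).2) ?_ (Real.exp_pos _).le (sq_nonneg _)
  refine (exp_carlemanWeight_le hz0 hz hK).trans ?_
  gcongr ?_ * ?_
  exact Real.rpow_le_rpow_of_nonpos hs hsz (by linarith)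

namespace PerforatedHarmonic

variable {ι : Type} {c : ι → ℂ} {J : Finset ι} {z : ℂ} {ρ R A : ℝ} {v : ℂ → ℝ}

theorem carlemanIntegrand_nonneg {t : ℝ} : 0 ≤ carlemanIntegrand c J t ρ R v z :=
  mul_nonneg (sq_nonneg _) (mul_nonneg carlemanDensity_nonneg (Real.exp_pos _).le)

theorem integral_carlemanIntegrand_le (hv : PerforatedHarmonic c R v)
    (hJ : ∀ i, i ∈ J ↔ ‖c i‖ ≤ R) (hR : 10 ^ 4 < R) {r : ℝ} (hr : 0 < r) (hrR : r ≤ R / 4)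
    {m M : ℝ} (hm : BoundedOff c v r m) (hM : BoundedOff c v R M) (hρ : ρ = r / 1000) (hA : 1 ≤ A)
    (hA' : ∀ s, |deriv Real.smoothTransition s| ≤ A ∧ |deriv (deriv Real.smoothTransition) s| ≤ A)
    {K t : ℝ} (hK0 : 1 ≤ K) (hK : ∀ z, ∑ i ∈ J, ((1 + ‖z - c i‖ ^ 2) ^ 2)⁻¹ ≤ K)
    (ht : 4 + (2 * K + 3) * R ≤ t) {F : Finset ι}
    (hF : F = {i ∈ J | ρ + 147 / 50 ≤ ‖c i‖ ∧ (‖c i‖ - 27 / 10) ^ 2 ≤ 197 / 200 * R ^ 2})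
    {L : ℝ} (hL : L = 1100 * A ^ 2 * Real.exp 56) :
    Integrable (carlemanIntegrand c J t ρ R v) ∧
    (t / (2 * R)) ^ 2 * ∫ z, carlemanIntegrand c J t ρ R v z ≤
      L ^ 2 * Real.exp (K + 1) * (((1 + 1 / ρ) ^ 2 * m) ^ 2 * (ρ ^ 2 / 2) ^ (-t) +
        M ^ 2 * (197 / 200 * R ^ 2) ^ (-t)) * (Real.pi * (2 * R) ^ 2) +
      (∑ i ∈ F, L ^ 2 * Real.exp (K + 1) *
        (v (nearPoint (c i)) ^ 2 * ((‖c i‖ - 27 / 10) ^ 2) ^ (-t))) * (Real.pi * 3 ^ 2) := by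
  have hρ0 : 0 < ρ := by linarith
  have hR0 : 0 < R := by linarith
  have ht0 : 0 < t := by nlinarith
  have hsub := tsupport_mul_totalCutoff_subset (c := c) (J := J) (v := v) hR0 hρ0
  set Ω : Set ℂ := {z | ρ ^ 2 / 2 ≤ ‖z‖ ^ 2 ∧ ‖z‖ ≤ R ∧ ∀ i ∈ J, 2 ≤ ‖z - c i‖}
  have hΩ0 : ∀ z ∈ Ω, z ≠ 0 := by
    rintro z hz rfl
    have h1 := hz.1
    rw [norm_zero] at h1
    nlinarith [sq_pos_of_pos hρ0]
  have hcomp : HasCompactSupport fun w => v w * totalCutoff c J ρ R w := by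
    refine HasCompactSupport.of_support_subset_isCompact (isCompact_closedBall (0 : ℂ) R) ?_
    refine (subset_tsupport _).trans (hsub.trans fun z hz => ?_)
    simpa using hz.2.1
  obtain ⟨hI1, hI2, hI3⟩ := carleman (hv.contDiff_mul_totalCutoff hJ hR hρ0) hcomp hsub
    (fun z hz => contDiffAt_carlemanWeight (c := c) (J := J) (t := t) (R := R) (hΩ0 z hz) 2)
    (fun z _ => contDiffAt_carlemanDensity (c := c) (J := J) (R := R) 1)
    (fun z _ => carlemanDensity_nonneg)
    (fun z hz => carlemanDensity_le_planeLaplacian (hΩ0 z hz) hz.2.2)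
    (fun z hz => carlemanWeight_radial_condition (hΩ0 z hz) hz.2.1 (hK z) ht)
    (fun z hz => hz.2.1) hR0 ht0
  refine ⟨hI1, hI3.trans (integral_le_of_le_sum_indicator_ball hI2 (by positivity) (by norm_num)
    (x := c) fun z => ?_)⟩
  have hX : 0 ≤ (1 + 1 / ρ) ^ 2 := sq_nonneg _
  have hp1 : 0 ≤ (ρ ^ 2 / 2) ^ (-t) := by positivity
  have hp2 : 0 ≤ (197 / 200 * R ^ 2) ^ (-t) := by positivity
  have hp3 : 0 ≤ L ^ 2 * Real.exp (K + 1) := by positivity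
  have hs1 : 0 ≤ ∑ i ∈ F, (ball (c i) 3).indicator (fun _ => L ^ 2 * Real.exp (K + 1) *
      (v (nearPoint (c i)) ^ 2 * ((‖c i‖ - 27 / 10) ^ 2) ^ (-t))) z :=
    Finset.sum_nonneg fun i _ => indicator_nonneg (fun _ _ => by positivity) _
  have hs2 : 0 ≤ (ball (0 : ℂ) (2 * R)).indicator (fun _ => L ^ 2 * Real.exp (K + 1) *
      (((1 + 1 / ρ) ^ 2 * m) ^ 2 * (ρ ^ 2 / 2) ^ (-t) + M ^ 2 * (197 / 200 * R ^ 2) ^ (-t))) z :=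
    indicator_nonneg (fun _ _ => by positivity) _
  have hind : ‖z‖ ≤ R → (ball (0 : ℂ) (2 * R)).indicator (fun _ => L ^ 2 * Real.exp (K + 1) *
      (((1 + 1 / ρ) ^ 2 * m) ^ 2 * (ρ ^ 2 / 2) ^ (-t) + M ^ 2 * (197 / 200 * R ^ 2) ^ (-t))) z =
      L ^ 2 * Real.exp (K + 1) *
      (((1 + 1 / ρ) ^ 2 * m) ^ 2 * (ρ ^ 2 / 2) ^ (-t) + M ^ 2 * (197 / 200 * R ^ 2) ^ (-t)) :=
    fun hz => indicator_of_mem (by rw [mem_ball_zero_iff]; linarith) _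
  rcases hv.planeLaplacian_cutoff_cases hJ hR hr hrR hm hM hρ hA hA' z with
    h | ⟨h1, h2, h3⟩ | ⟨h1, h2, h3⟩ | ⟨i, hi, hi1, hi2, hi3, hi4, hi5⟩
  · rw [h]
    simp only [ne_eq, OfNat.ofNat_ne_zero, not_false_eq_true, zero_pow, zero_mul]
    linarith
  · rw [← hL] at h3
    have h4 := sq_mul_exp_carlemanWeight_le (hK z) ht0.le h2 (by positivity) h1 h3
    rw [hind h2]
    have h5 : 0 ≤ L ^ 2 * Real.exp (K + 1) * (M ^ 2 * (197 / 200 * R ^ 2) ^ (-t)) := by positivity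
    refine h4.trans ?_
    linarith
  · rw [← hL] at h3
    have h4 := sq_mul_exp_carlemanWeight_le (hK z) ht0.le h2 (by positivity) h1 h3
    rw [hind h2]
    have h5 : 0 ≤ L ^ 2 * Real.exp (K + 1) *
      (((1 + 1 / ρ) ^ 2 * m) ^ 2 * (ρ ^ 2 / 2) ^ (-t)) := by positivity
    refine h4.trans ?_
    linarith
  · rw [← hL] at hi5
    have hc3 := hv.three_lt i
    have h2 : ‖z‖ ≤ R := by
      have := norm_sub_norm_le z (c i)
      have : ‖c i‖ - 27 / 10 ≤ 9925 / 10000 * R := le_of_sq_le_sq (by nlinarith) (by linarith)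
      linarith
    have h4 := sq_mul_exp_carlemanWeight_le (hK z) ht0.le h2
      (s := (‖c i‖ - 27 / 10) ^ 2) (pow_pos (by linarith) 2)
      (pow_le_pow_left₀ (by linarith) hi4 2) hi5
    have hiF : i ∈ F := by
      rw [hF, Finset.mem_filter]
      exact ⟨hi, hi1, hi2⟩
    have h5 := Finset.single_le_sum (f := fun i => (ball (c i) 3).indicator (fun _ =>
      L ^ 2 * Real.exp (K + 1) * (v (nearPoint (c i)) ^ 2 * ((‖c i‖ - 27 / 10) ^ 2) ^ (-t))) z)
      (fun i _ => indicator_nonneg (fun _ _ => by positivity) _) hiF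
    rw [indicator_of_mem (by rwa [mem_ball, dist_eq_norm])] at h5
    rw [mul_pow, sq_abs] at h4
    linarith

end PerforatedHarmonic

theorem mul_rpow_le_carlemanIntegrand {ι : Type} {c : ι → ℂ} {J : Finset ι} {t ρ R : ℝ} {v : ℂ → ℝ}
    {y : ℂ} {d s : ℝ} (hy : y ≠ 0) (hχ : totalCutoff c J ρ R y = 1) (hs : ‖y‖ ^ 2 ≤ s)
    (ht : 0 ≤ t) (hd0 : 0 ≤ d) (hd : d ≤ carlemanDensity c J R y) :
    v y ^ 2 * (d * s ^ (-t)) ≤ carlemanIntegrand c J t ρ R v y := by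
  have hy0 : 0 < ‖y‖ ^ 2 := by positivity
  rw [carlemanIntegrand, hχ, mul_one]
  refine mul_le_mul_of_nonneg_left (mul_le_mul hd ?_ ?_ (hd0.trans hd)) (sq_nonneg _)
  · exact (Real.rpow_le_rpow_of_nonpos hy0 hs (by linarith)).trans (le_exp_carlemanWeight hy)
  · exact Real.rpow_nonneg (hy0.le.trans hs) _

theorem totalCutoff_eq_one {ι : Type} {c : ι → ℂ} {J : Finset ι} {ρ R : ℝ} {y : ℂ} (hρ : 0 < ρ)
    (hR : 0 < R) (h1 : ∀ i ∈ J, 29 / 4 ≤ ‖y - c i‖ ^ 2) (h2 : ρ ≤ ‖y‖)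
    (h3 : ‖y‖ ^ 2 < 197 / 200 * R ^ 2) : totalCutoff c J ρ R y = 1 := by
  rw [totalCutoff, diskCutoff_eq_one h1, holeCutoff_eq_one hρ h2,
    (outerCutoff_eventuallyEq_one hR h3).self_of_nhds]
  norm_num

theorem le_carlemanDensity {ι : Type} {c : ι → ℂ} {J : Finset ι} {R : ℝ} {y : ℂ} {i : ι}
    (hi : i ∈ J) : 11 * ((1 + ‖y - c i‖ ^ 2) ^ 3)⁻¹ ≤ carlemanDensity c J R y := by
  have h := Finset.single_le_sum (f := fun i => ((1 + ‖y - c i‖ ^ 2) ^ 3)⁻¹)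
    (fun i _ => by positivity) hi
  have h2 : 0 ≤ (R ^ 2)⁻¹ := by positivity
  rw [carlemanDensity]
  linarith

theorem inv_sq_le_carlemanDensity {ι : Type} {c : ι → ℂ} {J : Finset ι} {R : ℝ} {y : ℂ} :
    4 * (R ^ 2)⁻¹ ≤ carlemanDensity c J R y := by
  have h : 0 ≤ ∑ i ∈ J, ((1 + ‖y - c i‖ ^ 2) ^ 3)⁻¹ := Finset.sum_nonneg fun i _ => by positivity
  rw [carlemanDensity]
  linarith

namespace PerforatedHarmonic

variable {ι : Type} {c : ι → ℂ} {J : Finset ι} {z : ℂ} {ρ R t : ℝ} {v : ℂ → ℝ}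

theorem sum_le_integral_carlemanIntegrand (hv : PerforatedHarmonic c R v) (hR : 10 ^ 4 < R)
    (hρ : 0 < ρ) (ht : 0 ≤ t) (hint : Integrable (carlemanIntegrand c J t ρ R v)) {F : Finset ι}
    (hF : F = {i ∈ J | ρ + 147 / 50 ≤ ‖c i‖ ∧ (‖c i‖ - 27 / 10) ^ 2 ≤ 197 / 200 * R ^ 2}) :
    (∑ i ∈ F, v (nearPoint (c i)) ^ 2 * ((‖c i‖ - 27 / 10) ^ 2) ^ (-t)) * (Real.pi * (3 / 50) ^ 2) ≤
      100 * Real.exp 56 ^ 2 * ∫ z, carlemanIntegrand c J t ρ R v z := by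
  have h := sum_mul_le_integral_of_disjoint_balls hint (fun _ => carlemanIntegrand_nonneg)
    (F := F) (x := fun i => nearPoint (c i)) (ρ := 3 / 50) (by norm_num)
    (m := fun i => (100 * Real.exp 56 ^ 2)⁻¹ *
      (v (nearPoint (c i)) ^ 2 * ((‖c i‖ - 27 / 10) ^ 2) ^ (-t))) ?_ ?_
  · rw [← Finset.mul_sum, mul_assoc, inv_mul_le_iff₀ (by positivity)] at h
    exact h
  · intro i _ j _ hij
    have h1 := norm_nearPoint_sub (hv.three_lt i)
    have h2 := norm_nearPoint_sub (hv.three_lt j)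
    have h3 := hv.sep i j hij
    rw [← dist_eq_norm] at h1 h2
    have h4 := dist_triangle4_right (c i) (c j) (nearPoint (c i)) (nearPoint (c j))
    rw [dist_comm (c i) (nearPoint _), dist_comm (c j) (nearPoint _)] at h4
    linarith
  · intro i hi y hy
    rw [hF, Finset.mem_filter] at hi
    obtain ⟨hi, hi1, hi2⟩ := hi
    have hc3 := hv.three_lt i
    have h1 := norm_nearPoint_sub hc3
    have h2 := norm_nearPoint hc3
    rw [mem_ball, dist_eq_norm] at hy
    have h3 : ‖y - c i‖ ≤ 147 / 50 := by
      have := norm_sub_le_norm_sub_add_norm_sub y (nearPoint (c i)) (c i)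
      linarith
    have h4 : 141 / 50 ≤ ‖y - c i‖ := by
      have := norm_sub_le_norm_sub_add_norm_sub (nearPoint (c i)) y (c i)
      rw [norm_sub_rev _ y] at this
      linarith
    have h5 : ‖y‖ ≤ ‖c i‖ - 141 / 50 := by
      have := norm_sub_norm_le y (nearPoint (c i))
      linarith
    have h6 : ρ ≤ ‖y‖ := by
      have := norm_sub_norm_le (c i) y
      rw [norm_sub_rev] at this
      linarith
    have h7 : ‖y‖ ^ 2 ≤ (‖c i‖ - 27 / 10) ^ 2 :=
      pow_le_pow_left₀ (norm_nonneg _) (by linarith) 2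
    have h7' : ‖y‖ ^ 2 < (‖c i‖ - 27 / 10) ^ 2 :=
      pow_lt_pow_left₀ (by linarith) (norm_nonneg _) two_ne_zero
    have hcR : ‖c i‖ + 5 ≤ R := by
      have : ‖c i‖ - 27 / 10 ≤ 9925 / 10000 * R := le_of_sq_le_sq (by nlinarith) (by linarith)
      linarith
    have hχ : totalCutoff c J ρ R y = 1 := by
      refine totalCutoff_eq_one hρ (by linarith) (fun j _ => ?_) h6 (by linarith)
      by_cases hij : j = i
      · subst hij
        nlinarith
      · have := le_dist_of_dist_le hv.sep hij (z := y) (by rw [dist_eq_norm]; linarith)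
        rw [dist_eq_norm] at this
        nlinarith
    have hden : 1 / 100 ≤ carlemanDensity c J R y := by
      refine le_trans ?_ (le_carlemanDensity hi)
      have : (1 + ‖y - c i‖ ^ 2) ^ 3 ≤ (1 + (147 / 50) ^ 2) ^ 3 := by gcongr
      rw [← div_eq_mul_inv, le_div_iff₀ (by positivity)]
      linarith
    have hlow := mul_rpow_le_carlemanIntegrand (v := v) (t := t)
      (norm_pos_iff.1 (hρ.trans_le h6)) hχ h7 ht (by norm_num) hden
    refine le_trans ?_ hlow
    have hcmp := hv.abs_le_exp_mul hcR (z := nearPoint (c i)) (w := y)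
      (by rw [dist_eq_norm, h1]; norm_num) (by rw [dist_eq_norm, h1]; norm_num)
      (by rw [dist_eq_norm]; linarith) (by rw [dist_eq_norm]; linarith)
    have hsq : v (nearPoint (c i)) ^ 2 ≤ Real.exp 56 ^ 2 * v y ^ 2 := by
      rw [← sq_abs, ← sq_abs (v y), ← mul_pow]
      exact pow_le_pow_left₀ (abs_nonneg _) hcmp 2
    have hp : 0 ≤ ((‖c i‖ - 27 / 10) ^ 2) ^ (-t) := by positivity
    calc (100 * Real.exp 56 ^ 2)⁻¹ *
          (v (nearPoint (c i)) ^ 2 * ((‖c i‖ - 27 / 10) ^ 2) ^ (-t))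
        ≤ (100 * Real.exp 56 ^ 2)⁻¹ *
          (Real.exp 56 ^ 2 * v y ^ 2 * ((‖c i‖ - 27 / 10) ^ 2) ^ (-t)) := by gcongr
      _ = v y ^ 2 * (1 / 100 * ((‖c i‖ - 27 / 10) ^ 2) ^ (-t)) := by
        field_simp

theorem le_integral_carlemanIntegrand (hv : PerforatedHarmonic c R v) (hR : 10 ^ 4 < R)
    (hρ : 0 < ρ) (ht : 0 ≤ t) (hint : Integrable (carlemanIntegrand c J t ρ R v))
    {M : ℝ} (hM : BoundedOff c v R M) (hM0 : 0 < M) (hz : ‖z‖ < R - R / 64) (hρz : ρ ≤ ‖z‖)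
    (hzc : ∀ i, 3 < dist z (c i)) {q : ℝ} (hq0 : 0 < q) (hq1 : q ≤ 1) (hvz : q * M / 2 ≤ |v z|) :
    (q * M / 4) ^ 2 * (4 * (R ^ 2)⁻¹ * (96924 / 100000 * R ^ 2) ^ (-t)) *
      (Real.pi * (q / (64 * Real.exp 56)) ^ 2) ≤ ∫ z, carlemanIntegrand c J t ρ R v z := by
  obtain ⟨η, hη⟩ : ∃ η, η = q / (64 * Real.exp 56) := ⟨_, rfl⟩
  have hη0 : 0 < η := by rw [hη]; positivity
  have hη1 : 2 * η ≤ 1 / 32 := by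
    rw [hη, mul_div_assoc', div_le_div_iff₀ (by positivity) (by norm_num)]
    have := Real.one_le_exp (show (0 : ℝ) ≤ 56 by norm_num)
    linarith
  have hz0 : 0 < ‖z‖ := hρ.trans_le hρz
  have hη2 : 2 * η * (8 * (Real.exp 56 * M)) = q * M / 4 := by
    rw [hη]
    field_simp
    norm_num
  obtain ⟨b, hb⟩ : ∃ b : ℂ, b = ((1 + η / ‖z‖ : ℝ) : ℂ) * z := ⟨_, rfl⟩
  have hb1 : ‖b‖ = ‖z‖ + η := by
    rw [hb, norm_mul, Complex.norm_real, Real.norm_eq_abs, abs_of_pos (by positivity)]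
    field_simp
  have hb2 : ‖b - z‖ = η := by
    have : b - z = ((η / ‖z‖ : ℝ) : ℂ) * z := by
      rw [hb]
      push_cast
      ring
    rw [this, norm_mul, Complex.norm_real, Real.norm_eq_abs, abs_of_pos (by positivity)]
    field_simp
  have hclose : ∀ y ∈ closedBall z (2 * η), ‖y‖ < R - 21 ∧ ∀ i, 11 / 4 ≤ dist y (c i) := by
    intro y hy
    rw [mem_closedBall] at hy
    constructor
    · have := norm_sub_norm_le y z
      rw [← dist_eq_norm] at this
      linarith
    · intro i
      have := dist_triangle_left z (c i) y
      linarith [hzc i]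
  rw [← hη]
  have h := sum_mul_le_integral_of_disjoint_balls hint (fun _ => carlemanIntegrand_nonneg)
    (F := {()}) (x := fun _ => b) hη0.le (by simp)
    (m := fun _ => (q * M / 4) ^ 2 * (4 * (R ^ 2)⁻¹ * (96924 / 100000 * R ^ 2) ^ (-t))) ?_
  · rwa [Finset.sum_singleton] at h
  intro _ _ y hy
  rw [mem_ball, dist_eq_norm] at hy
  have hyz : y ∈ closedBall z (2 * η) := by
    rw [mem_closedBall, dist_eq_norm]
    have := norm_sub_le_norm_sub_add_norm_sub y b z
    linarith
  obtain ⟨hy1, hy2⟩ := hclose y hyz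
  have hy3 : ‖z‖ ≤ ‖y‖ := by
    have := norm_sub_norm_le b y
    rw [norm_sub_rev] at this
    linarith
  have hy4 : ‖y‖ ≤ 98449 / 100000 * R := by
    have := norm_sub_norm_le y z
    rw [mem_closedBall, dist_eq_norm] at hyz
    linarith
  have hy5 : ‖y‖ ^ 2 ≤ 96924 / 100000 * R ^ 2 := by
    have : ‖y‖ ^ 2 ≤ (98449 / 100000 * R) ^ 2 := pow_le_pow_left₀ (norm_nonneg _) hy4 2
    nlinarith
  have hχ : totalCutoff c J ρ R y = 1 := by
    refine totalCutoff_eq_one hρ (by linarith) (fun j _ => ?_) (hρz.trans hy3) ?_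
    · rw [← dist_eq_norm]
      nlinarith [hy2 j]
    · nlinarith
  have hlow := mul_rpow_le_carlemanIntegrand (v := v) (t := t)
    (norm_pos_iff.1 (hz0.trans_le hy3)) hχ hy5 ht (by positivity) (inv_sq_le_carlemanDensity (c := c)
    (J := J))
  refine le_trans ?_ hlow
  have hmv := (convex_closedBall z (2 * η)).norm_image_sub_le_of_norm_fderiv_le (𝕜 := ℝ) (f := v)
    (C := 8 * (Real.exp 56 * M)) (x := z) (y := y)
    (fun w hw => (hv.harm w (by linarith [(hclose w hw).1])
      fun i => by linarith [(hclose w hw).2 i]).1.differentiableAt (by norm_num))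
    (fun w hw => hv.norm_fderiv_le_of_boundedOff le_rfl hM (hclose w hw).1
      fun i => by linarith [(hclose w hw).2 i])
    (mem_closedBall_self (by positivity)) hyz
  have hvy : q * M / 4 ≤ |v y| := by
    have h1 : 8 * (Real.exp 56 * M) * ‖y - z‖ ≤ q * M / 4 := by
      rw [mem_closedBall, dist_eq_norm] at hyz
      rw [← hη2, mul_comm]
      gcongr
    have h2 := norm_sub_norm_le (v z) (v y)
    rw [norm_sub_rev, Real.norm_eq_abs, Real.norm_eq_abs] at h2
    linarith
  have hp : 0 ≤ 4 * (R ^ 2)⁻¹ * (96924 / 100000 * R ^ 2) ^ (-t) := by positivity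
  refine mul_le_mul_of_nonneg_right ?_ hp
  rw [← sq_abs (v y)]
  exact pow_le_pow_left₀ (by positivity) hvy 2

end PerforatedHarmonic

theorem pow_four_mul_rpow_le {R N t : ℝ} (hR : 0 < R) (hN : 0 ≤ N) (ht : 500 * (R + N) ≤ t) :
    R ^ 4 * (197 / 200 * R ^ 2) ^ (-t) ≤
      32 * Real.exp (-N) ^ 4 * (96924 / 100000 * R ^ 2) ^ (-t) := by
  have h1 : (197 / 200 * R ^ 2) ^ (-t) =
      (98500 / 96924 : ℝ) ^ (-t) * (96924 / 100000 * R ^ 2) ^ (-t) := by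
    rw [← Real.mul_rpow (by norm_num) (by positivity)]
    congr 1
    ring
  have h2 : (98500 / 96924 : ℝ) ^ (-t) ≤ Real.exp (-R + -(4 * N)) := by
    rw [Real.rpow_def_of_pos (by norm_num), Real.exp_le_exp]
    have := Real.one_sub_inv_le_log_of_pos (show (0 : ℝ) < 98500 / 96924 by norm_num)
    have h3 : 1 / 100 ≤ Real.log (98500 / 96924) := le_trans (by norm_num) this
    nlinarith
  have h3 : R ^ 4 ≤ 32 * Real.exp R := by
    have h := Real.pow_div_factorial_le_exp R hR.le 4
    rw [div_le_iff₀ (by positivity)] at h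
    norm_num [Nat.factorial] at h
    linarith [Real.exp_pos R]
  rw [h1, ← mul_assoc]
  refine mul_le_mul_of_nonneg_right ?_ (by positivity)
  calc R ^ 4 * (98500 / 96924 : ℝ) ^ (-t) ≤ 32 * Real.exp R * Real.exp (-R + -(4 * N)) := by gcongr
    _ = 32 * Real.exp (-N) ^ 4 := by
      rw [mul_assoc, ← Real.exp_add, ← Real.exp_nat_mul]
      congr 2
      push_cast
      ring

namespace PerforatedHarmonic

variable {ι : Type} {c : ι → ℂ} {J : Finset ι} {z : ℂ} {ρ R A : ℝ} {v : ℂ → ℝ}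

theorem sq_mul_rpow_le_of_le_abs (hv : PerforatedHarmonic c R v)
    (hJ : ∀ i, i ∈ J ↔ ‖c i‖ ≤ R) (hR : 10 ^ 4 < R) {r : ℝ} (hr : 0 < r) (hrR : r ≤ R / 4)
    {m M : ℝ} (hm : BoundedOff c v r m) (hM : BoundedOff c v R M) (hρ : ρ = r / 1000) (hA : 1 ≤ A)
    (hA' : ∀ s, |deriv Real.smoothTransition s| ≤ A ∧ |deriv (deriv Real.smoothTransition) s| ≤ A)
    {K t N : ℝ} (hK0 : 1 ≤ K) (hK : ∀ z, ∑ i ∈ J, ((1 + ‖z - c i‖ ^ 2) ^ 2)⁻¹ ≤ K)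
    (ht : 4 + (2 * K + 3) * R ≤ t) (hN : 0 ≤ N) (htN : 500 * (R + N) ≤ t) {Q : ℝ}
    (hQ : Q = (1100 * A ^ 2 * Real.exp 56) ^ 2 * Real.exp (K + 1) * Real.exp 56 ^ 2)
    (htQ : 2 ^ 23 * Q ≤ (t / (2 * R)) ^ 2) (hM0 : 0 < M) (hz : ‖z‖ < R - R / 64) (hrz : r ≤ ‖z‖)
    (hzc : ∀ i, 3 < dist z (c i)) (hvz : Real.exp (-N) * M / 2 ≤ |v z|) :
    Real.exp (-N) ^ 4 * M ^ 2 * (R ^ 2) ^ (-t) ≤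
      (R * (1 + 1 / ρ)) ^ 4 * m ^ 2 * (ρ ^ 2 / 2) ^ (-t) := by
  have hR0 : 0 < R := by linarith
  have hρ0 : 0 < ρ := by linarith
  have ht0 : 0 < t := by nlinarith
  obtain ⟨F, hF⟩ : ∃ F : Finset ι, F = {i ∈ J | ρ + 147 / 50 ≤ ‖c i‖ ∧
    (‖c i‖ - 27 / 10) ^ 2 ≤ 197 / 200 * R ^ 2} := ⟨_, rfl⟩
  obtain ⟨L, hL⟩ : ∃ L, L = 1100 * A ^ 2 * Real.exp 56 := ⟨_, rfl⟩
  obtain ⟨hint, h1⟩ := hv.integral_carlemanIntegrand_le hJ hR hr hrR hm hM hρ hA hA' hK0 hK ht hF hL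
  have h2 := hv.sum_le_integral_carlemanIntegrand hR hρ0 ht0.le hint hF
  have h3 := hv.le_integral_carlemanIntegrand hR hρ0 ht0.le hint hM hM0 hz (by linarith) hzc
    (Real.exp_pos (-N)) (Real.exp_le_one_iff.2 (by linarith)) hvz
  have h4 := pow_four_mul_rpow_le hR0 hN htN
  have h5 : (R ^ 2) ^ (-t) ≤ (96924 / 100000 * R ^ 2) ^ (-t) :=
    Real.rpow_le_rpow_of_nonpos (by positivity) (by nlinarith) (by linarith)
  rw [← Finset.mul_sum] at h1
  rw [← hL] at hQ
  have hL0 : 0 < L := by rw [hL]; positivity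
  have hQ0 : 0 < Q := by rw [hQ]; positivity
  have hE := Real.exp_pos 56
  have hK1 := Real.exp_pos (K + 1)
  have hq := Real.exp_pos (-N)
  have hd : 0 < (96924 / 100000 * R ^ 2) ^ (-t) := by positivity
  have hπ := Real.pi_pos
  generalize (∑ i ∈ F, v (nearPoint (c i)) ^ 2 * ((‖c i‖ - 27 / 10) ^ 2) ^ (-t)) = S at h1 h2
  generalize (∫ z, carlemanIntegrand c J t ρ R v z) = I at h1 h2 h3
  generalize (t / (2 * R)) ^ 2 = κ at h1 htQ
  generalize (96924 / 100000 * R ^ 2) ^ (-t) = d at h3 h4 h5 hd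
  generalize (197 / 200 * R ^ 2) ^ (-t) = b at h1 h4
  generalize (ρ ^ 2 / 2) ^ (-t) = a at h1 ⊢
  generalize (R ^ 2) ^ (-t) = a' at h5 ⊢
  generalize 1 + 1 / ρ = X at h1 ⊢
  generalize Real.exp 56 = E at h2 h3 hQ hE
  generalize Real.exp (K + 1) = K' at h1 hQ hK1
  generalize Real.exp (-N) = q at h3 h4 hq ⊢
  have hI : 0 ≤ I := le_trans (by positivity) h3
  -- absorb the contribution of the disks
  have e1 : L ^ 2 * K' * S * (Real.pi * 3 ^ 2) ≤ 250000 * Q * I := by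
    calc L ^ 2 * K' * S * (Real.pi * 3 ^ 2)
        = 2500 * (L ^ 2 * K') * (S * (Real.pi * (3 / 50) ^ 2)) := by ring
      _ ≤ 2500 * (L ^ 2 * K') * (100 * E ^ 2 * I) := by gcongr
      _ = 250000 * Q * I := by rw [hQ]; ring
  have e2 : κ / 2 * I ≤ L ^ 2 * K' * ((X ^ 2 * m) ^ 2 * a + M ^ 2 * b) * (Real.pi * (2 * R) ^ 2) := by
    have : 250000 * Q * I ≤ κ / 2 * I := mul_le_mul_of_nonneg_right (by linarith) hI
    linarith
  have e3 : 2 ^ 22 * Q * I ≤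
      L ^ 2 * K' * ((X ^ 2 * m) ^ 2 * a + M ^ 2 * b) * (Real.pi * (2 * R) ^ 2) :=
    le_trans (mul_le_mul_of_nonneg_right (by linarith) hI) e2
  have e4 : 2 ^ 22 * Q * ((q * M / 4) ^ 2 * (4 * (R ^ 2)⁻¹ * d) * (Real.pi * (q / (64 * E)) ^ 2)) =
      L ^ 2 * K' * (Real.pi * (2 * R) ^ 2) / R ^ 4 * (64 * (q ^ 4 * M ^ 2 * d)) := by
    rw [hQ]
    field_simp
    norm_num
  have e5 : L ^ 2 * K' * (Real.pi * (2 * R) ^ 2) / R ^ 4 * (64 * (q ^ 4 * M ^ 2 * d)) ≤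
      L ^ 2 * K' * (Real.pi * (2 * R) ^ 2) / R ^ 4 *
        (R ^ 4 * ((X ^ 2 * m) ^ 2 * a + M ^ 2 * b)) := by
    rw [← e4]
    refine (mul_le_mul_of_nonneg_left h3 (by positivity)).trans (e3.trans_eq ?_)
    field_simp
  have e6 := le_of_mul_le_mul_left e5 (by positivity)
  have e7 : M ^ 2 * (R ^ 4 * b) ≤ M ^ 2 * (32 * q ^ 4 * d) :=
    mul_le_mul_of_nonneg_left h4 (sq_nonneg _)
  have e8 : q ^ 4 * M ^ 2 * a' ≤ q ^ 4 * M ^ 2 * d := mul_le_mul_of_nonneg_left h5 (by positivity)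
  have e9 : 0 ≤ q ^ 4 * M ^ 2 * d := by positivity
  linarith

end PerforatedHarmonic

theorem exists_three_balls_exponent : ∃ C : ℝ, 0 < C ∧
    ∀ (ι : Type) (c : ι → ℂ) (R r N m M : ℝ) (v : ℂ → ℝ), PerforatedHarmonic c R v →
      10 ^ 4 < R → 0 < r → r ≤ R / 4 → 0 ≤ N → BoundedOff c v r m → BoundedOff c v R M → 0 < M →
      (∃ z, ‖z‖ < R - R / 64 ∧ (∀ i, 3 < dist z (c i)) ∧ Real.exp (-N) * M / 2 ≤ |v z|) →
      (r / R) ^ (C * (R + N)) * M ≤ m := by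
  obtain ⟨A, hA, hA'⟩ := exists_smoothTransition_bound
  obtain ⟨K, hK0, hK⟩ := exists_sum_inv_sq_le
  obtain ⟨Q, hQ⟩ : ∃ Q, Q = (1100 * A ^ 2 * Real.exp 56) ^ 2 * Real.exp (K + 1) *
    Real.exp 56 ^ 2 := ⟨_, rfl⟩
  have hQ0 : 0 < Q := by rw [hQ]; positivity
  obtain ⟨C₁, hC₁⟩ : ∃ C₁, C₁ = 2 ^ 23 * Q + 4 * K + 500 := ⟨_, rfl⟩
  refine ⟨7 * C₁ + 3, by linarith, ?_⟩
  rintro ι c R r N m M v hv hR hr hrR hN hm hM hM0 ⟨z, hz, hzc, hvz⟩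
  have hR0 : 0 < R := by linarith
  obtain ⟨y, hy⟩ : ∃ y, y = r / R := ⟨_, rfl⟩
  have hy0 : 0 < y := by rw [hy]; positivity
  have hy4 : y ≤ 1 / 4 := by
    rw [hy, div_le_iff₀ hR0]
    linarith
  have hm0 : 0 ≤ m := (abs_nonneg _).trans
    (hm 0 (by simpa using hr) fun i => by simpa [dist_eq_norm] using hv.three_lt i)
  have hexp : ∀ {s : ℝ}, 0 ≤ s → y ^ s ≤ Real.exp (-s) := fun {s} hs => by
    have : y ≤ Real.exp (-1) := by
      rw [Real.exp_neg]
      refine hy4.trans ?_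
      rw [one_div]
      exact inv_anti₀ (Real.exp_pos 1) (by linarith [Real.exp_one_lt_d9])
    calc y ^ s ≤ Real.exp (-1) ^ s := Real.rpow_le_rpow hy0.le this hs
      _ = Real.exp (-s) := by rw [← Real.exp_mul, neg_one_mul]
  rw [← hy]
  have hRN : 0 < R + N := by linarith
  have hmono : ∀ {p : ℝ}, p ≤ (7 * C₁ + 3) * (R + N) → y ^ p * M ≤ m →
      y ^ ((7 * C₁ + 3) * (R + N)) * M ≤ m := fun {p} hp h => by
    refine le_trans (mul_le_mul_of_nonneg_right ?_ hM0.le) h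
    exact Real.rpow_le_rpow_of_exponent_ge hy0 (by linarith) hp
  rcases lt_or_ge ‖z‖ r with hzr | hzr
  · refine hmono (p := N + 1) (by nlinarith) ?_
    rw [Real.rpow_add hy0, Real.rpow_one]
    calc y ^ N * y * M ≤ Real.exp (-N) * (1 / 2) * M := by
          gcongr
          · exact hexp hN
          · linarith
      _ = Real.exp (-N) * M / 2 := by ring
      _ ≤ m := hvz.trans (hm z hzr hzc)
  obtain ⟨t, ht⟩ : ∃ t, t = C₁ * (R + N) := ⟨_, rfl⟩
  have hC₁R : C₁ * R ≤ t := by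
    rw [ht]
    have : 0 ≤ C₁ := by linarith
    gcongr
    linarith
  have ht0 : 0 < t := by
    rw [ht]
    exact mul_pos (by linarith) hRN
  have hfin := finite_setOf_norm_le hv.sep R
  have hκ : 2 ^ 23 * Q ≤ (t / (2 * R)) ^ 2 := by
    have h1 : C₁ / 2 ≤ t / (2 * R) := by
      rw [div_le_div_iff₀ (by norm_num) (by positivity)]
      linarith
    have h2 : (C₁ / 2) ^ 2 ≤ (t / (2 * R)) ^ 2 := pow_le_pow_left₀ (by linarith) h1 2
    nlinarith
  have key := hv.sq_mul_rpow_le_of_le_abs (J := hfin.toFinset) (fun i => by simp) hR hr hrR hm hM rfl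
    hA hA' hK0 (fun z => hK ι c hv.sep _ z) (t := t) (N := N) (by nlinarith) hN (by
      rw [ht]
      gcongr
      linarith) hQ hκ hM0 hz hzr hzc hvz
  have hrR' : r = y * R := by rw [hy]; field_simp
  have h1 : y ^ (R + 6) * (R * (1 + 1 / (r / 1000))) ≤ 1 := by
    have e1 : y ^ (R + 6) = y ^ R * y ^ 5 * y := by
      rw [Real.rpow_add hy0, show (6 : ℝ) = (6 : ℕ) by norm_num, Real.rpow_natCast]
      ring
    have e2 : y ^ R ≤ R⁻¹ := by
      refine (hexp hR0.le).trans ?_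
      rw [Real.exp_neg]
      exact inv_anti₀ hR0 (by linarith [Real.add_one_le_exp R])
    have e3 : y ^ 5 ≤ (1 / 4) ^ 5 := by gcongr
    calc y ^ (R + 6) * (R * (1 + 1 / (r / 1000))) = y ^ R * y ^ 5 * (y * R + 1000) := by
          rw [e1, hrR']
          field_simp
      _ ≤ R⁻¹ * (1 / 4) ^ 5 * (1 / 4 * R + 1000) := by gcongr
      _ ≤ 1 := by
          rw [mul_assoc, inv_mul_le_iff₀ hR0]
          linarith
  have h2 : y ^ (13 : ℝ) * R ^ 2 ≤ (r / 1000) ^ 2 / 2 := by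
    have e3 : y ^ 11 ≤ (1 / 4) ^ 11 := by gcongr
    calc y ^ (13 : ℝ) * R ^ 2 = (y * R) ^ 2 * y ^ 11 := by
          rw [show (13 : ℝ) = (13 : ℕ) by norm_num, Real.rpow_natCast]
          ring
      _ ≤ (y * R) ^ 2 * (1 / 4) ^ 11 := by gcongr
      _ ≤ (r / 1000) ^ 2 / 2 := by
          rw [hrR']
          nlinarith [sq_nonneg (y * R)]
  refine hmono (p := 2 * N + 2 * (R + 6) + 13 / 2 * t) ?_ ?_
  · rw [ht]
    nlinarith
  refine le_of_sq_le_sq ?_ hm0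
  have h3 : ((r / 1000) ^ 2 / 2) ^ (-t) ≤ y ^ (-(13 * t)) * (R ^ 2) ^ (-t) := by
    refine (Real.rpow_le_rpow_of_nonpos (by positivity) h2 (by linarith)).trans_eq ?_
    rw [Real.mul_rpow (by positivity) (by positivity), ← Real.rpow_mul hy0.le, mul_neg]
  have h4 : Real.exp (-N) ^ 4 * M ^ 2 ≤
      (R * (1 + 1 / (r / 1000))) ^ 4 * m ^ 2 * y ^ (-(13 * t)) := by
    refine le_of_mul_le_mul_right (key.trans ?_) (show 0 < (R ^ 2) ^ (-t) by positivity)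
    rw [mul_assoc _ (y ^ _)]
    gcongr
  have h5 : y ^ (2 * N + 2 * (R + 6) + 13 / 2 * t) * y ^ (2 * N + 2 * (R + 6) + 13 / 2 * t) =
      (y ^ N) ^ 4 * (y ^ (R + 6)) ^ 4 * y ^ (13 * t) := by
    rw [← Real.rpow_add hy0, ← Real.rpow_mul_natCast hy0.le, ← Real.rpow_mul_natCast hy0.le,
      ← Real.rpow_add hy0, ← Real.rpow_add hy0]
    congr 1
    push_cast
    ring
  have h6 : y ^ (13 * t) * y ^ (-(13 * t)) = 1 := by
    rw [← Real.rpow_add hy0, add_neg_cancel, Real.rpow_zero]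
  calc (y ^ (2 * N + 2 * (R + 6) + 13 / 2 * t) * M) ^ 2
      = (y ^ (R + 6)) ^ 4 * y ^ (13 * t) * ((y ^ N) ^ 4 * M ^ 2) := by
        rw [mul_pow, sq (y ^ _), h5]
        ring
    _ ≤ (y ^ (R + 6)) ^ 4 * y ^ (13 * t) * (Real.exp (-N) ^ 4 * M ^ 2) := by
        gcongr
        exact hexp hN
    _ ≤ (y ^ (R + 6)) ^ 4 * y ^ (13 * t) *
        ((R * (1 + 1 / (r / 1000))) ^ 4 * m ^ 2 * y ^ (-(13 * t))) := by gcongr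
    _ = (y ^ (R + 6) * (R * (1 + 1 / (r / 1000)))) ^ 4 * m ^ 2 *
        (y ^ (13 * t) * y ^ (-(13 * t))) := by ring
    _ ≤ 1 ^ 4 * m ^ 2 * 1 := by
        rw [h6]
        gcongr
    _ = m ^ 2 := by ring

theorem orthonormalBasisOneI_repr_one :
    Complex.orthonormalBasisOneI.repr 1 = EuclideanSpace.single 0 1 := by
  have := Complex.orthonormalBasisOneI.repr_self 0
  simpa using this

theorem orthonormalBasisOneI_repr_I :
    Complex.orthonormalBasisOneI.repr Complex.I = EuclideanSpace.single 1 1 := by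
  have := Complex.orthonormalBasisOneI.repr_self 1
  simpa using this

theorem planeLaplacian_comp_repr (u : E2 → ℝ) (z : ℂ) :
    planeLaplacian (u ∘ Complex.orthonormalBasisOneI.repr) z =
      lap u (Complex.orthonormalBasisOneI.repr z) := by
  have h : ∀ (f : E2 → ℝ) (w b : ℂ), fderiv ℝ (f ∘ Complex.orthonormalBasisOneI.repr) w b =
      fderiv ℝ f (Complex.orthonormalBasisOneI.repr w) (Complex.orthonormalBasisOneI.repr b) := by
    intro f w b
    have := Complex.orthonormalBasisOneI.repr.toContinuousLinearEquiv.comp_right_fderiv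
      (f := f) (x := w)
    exact congrArg (fun L => L b) this
  have h1 : partialRe (u ∘ Complex.orthonormalBasisOneI.repr) =
      (fun y => fderiv ℝ u y (EuclideanSpace.single 0 1)) ∘ Complex.orthonormalBasisOneI.repr := by
    funext w
    rw [partialRe, h, orthonormalBasisOneI_repr_one]
    rfl
  have h2 : partialIm (u ∘ Complex.orthonormalBasisOneI.repr) =
      (fun y => fderiv ℝ u y (EuclideanSpace.single 1 1)) ∘ Complex.orthonormalBasisOneI.repr := by
    funext w
    rw [partialIm, h, orthonormalBasisOneI_repr_I]
    rfl
  rw [planeLaplacian, h1, h2, partialRe, partialIm, h, h, orthonormalBasisOneI_repr_one,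
    orthonormalBasisOneI_repr_I, lap, Fin.sum_univ_two]

theorem dist_ge_of_unitBallsSeparated {n : ℕ} {ι : Type} {c : ι → EuclideanSpace ℝ (Fin n)} {L : ℝ}
    (h : UnitBallsSeparated c L) {i j : ι} (hij : i ≠ j) : L ≤ dist (c i) (c j) :=
  h i j hij _ (mem_closedBall_self zero_le_one) _ (mem_closedBall_self zero_le_one)

theorem perforatedHarmonic_comp_repr {ι : Type} {c : ι → E2} {R : ℝ} {u : E2 → ℝ}
    (hsep : UnitBallsSeparated c 100) (h0 : (0 : E2) ∉ ⋃ i, closedBall (c i) 3)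
    (hu : HarmonicOnSet u (ball (0 : E2) R \ ⋃ i, closedBall (c i) 1))
    (hs : ∀ i, NoSignChange u ((closedBall (c i) 5 \ closedBall (c i) 1) ∩ ball (0 : E2) R)) :
    PerforatedHarmonic (fun i => Complex.orthonormalBasisOneI.repr.symm (c i)) R
      (u ∘ Complex.orthonormalBasisOneI.repr) := by
  set e := Complex.orthonormalBasisOneI.repr
  have hdist : ∀ z i, dist z (e.symm (c i)) = dist (e z) (c i) := fun z i => by
    rw [← e.dist_map, e.apply_symm_apply]
  have hsep' : ∀ i j, i ≠ j → 100 ≤ dist (e.symm (c i)) (e.symm (c j)) := fun i j hij => by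
    rw [e.symm.dist_map]
    exact dist_ge_of_unitBallsSeparated hsep hij
  refine ⟨hsep', fun i => ?_, fun z hz hzc => ?_, fun i => ?_⟩
  · rw [e.symm.norm_map]
    simp only [mem_iUnion, mem_closedBall, dist_zero_left, not_exists, not_le] at h0
    exact h0 i
  · have hpt : ∀ w : ℂ, ‖w‖ < R → (∀ i, 1 < dist w (e.symm (c i))) →
        ContDiffAt ℝ 2 (u ∘ e) w ∧ planeLaplacian (u ∘ e) w = 0 := fun w hw hwc => by
      have h1 := hu (e w) ⟨by simpa using hw, by simpa [← hdist] using hwc⟩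
      exact ⟨h1.1.comp w e.contDiff.contDiffAt, (planeLaplacian_comp_repr u w).trans h1.2⟩
    refine ⟨(hpt z hz hzc).1, ?_⟩
    have hnear : ∀ᶠ w in 𝓝 z, ∀ i, 1 < dist w (e.symm (c i)) := by
      by_cases hi : ∃ i, dist z (e.symm (c i)) ≤ 8
      · obtain ⟨i, hi⟩ := hi
        have h1 : ∀ᶠ w in 𝓝 z, 1 < dist w (e.symm (c i)) :=
          (continuous_id.dist continuous_const).continuousAt.eventually (lt_mem_nhds (hzc i))
        filter_upwards [h1, ball_mem_nhds z one_pos] with w hw hwz j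
        by_cases hji : j = i
        · exact hji ▸ hw
        · have h2 := dist_triangle w z (e.symm (c i))
          rw [mem_ball] at hwz
          linarith [le_dist_of_dist_le (c := fun i => e.symm (c i)) hsep' hji
            (show dist w (e.symm (c i)) ≤ 10 by linarith)]
      · push Not at hi
        filter_upwards [ball_mem_nhds z one_pos] with w hw j
        have h2 := dist_triangle_left z (e.symm (c j)) w
        rw [mem_ball] at hw
        linarith [hi j]
    filter_upwards [hnear, continuous_norm.continuousAt.eventually (gt_mem_nhds hz)] with w hw hwR
    rw [← planeLaplacian_eq_laplacian (hpt w hwR hw).1, (hpt w hwR hw).2]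
    rfl
  · refine (hs i).imp (fun h z h1 h5 hz => ?_) (fun h z h1 h5 hz => ?_) <;>
    · rw [hdist] at h1 h5
      exact h (e z) ⟨⟨h5, by simpa using h1⟩, by simpa using hz⟩

theorem abs_le_supAbs {n : ℕ} {u : EuclideanSpace ℝ (Fin n) → ℝ} {s : Set (EuclideanSpace ℝ (Fin n))}
    (hb : BddAbove ((fun z => |u z|) '' s)) {x : EuclideanSpace ℝ (Fin n)} (hx : x ∈ s) :
    |u x| ≤ supAbs u s :=
  le_csSup hb (mem_image_of_mem _ hx)

theorem supAbs_nonneg {n : ℕ} (u : EuclideanSpace ℝ (Fin n) → ℝ)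
    (s : Set (EuclideanSpace ℝ (Fin n))) : 0 ≤ supAbs u s := by
  refine Real.sSup_nonneg ?_
  rintro _ ⟨x, -, rfl⟩
  exact abs_nonneg _

/-- **Theorem 6 (harmonic counterpart of the main local theorem).** -/
theorem harmonic_local_three_balls :
    ∃ C : ℝ, 0 < C ∧
      ∀ (ι : Type) (c : ι → E2) (R r N : ℝ) (u : E2 → ℝ),
        UnitBallsSeparated c 100 →
        ((0 : E2) ∉ ⋃ i, closedBall (c i) 3) →
        10 ^ 4 < R → 0 < r → r ≤ R / 4 → 0 ≤ N →
        HarmonicOnSet u (ball (0 : E2) R \ ⋃ i, closedBall (c i) 1) →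
        (∀ i, NoSignChange u ((closedBall (c i) 5 \ closedBall (c i) 1) ∩ ball (0 : E2) R)) →
        Real.exp (-N) * supAbs u (ball (0 : E2) R \ ⋃ i, closedBall (c i) 3) ≤
          supAbs u (ball (0 : E2) (R - R / 64) \ ⋃ i, closedBall (c i) 3) →
        (r / R) ^ (C * (R + N)) * supAbs u (ball (0 : E2) R \ ⋃ i, closedBall (c i) 3) ≤
          supAbs u (ball (0 : E2) r \ ⋃ i, closedBall (c i) 3) := by
  obtain ⟨C, hC, h⟩ := exists_three_balls_exponent
  refine ⟨C, hC, fun ι c R r N u hsep h0 hR hr hrR hN hu hs hsup => ?_⟩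
  have hv := perforatedHarmonic_comp_repr hsep h0 hu hs
  set e := Complex.orthonormalBasisOneI.repr
  have hdist : ∀ z i, dist z (e.symm (c i)) = dist (e z) (c i) := fun z i => by
    rw [← e.dist_map, e.apply_symm_apply]
  rcases (supAbs_nonneg u (ball (0 : E2) R \ ⋃ i, closedBall (c i) 3)).eq_or_lt with hM | hM
  · rw [← hM, mul_zero]
    exact supAbs_nonneg _ _
  have hb : BddAbove ((fun z => |u z|) '' (ball (0 : E2) R \ ⋃ i, closedBall (c i) 3)) := by
    by_contra hb
    rw [supAbs, Real.sSup_of_not_bddAbove hb] at hM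
    exact hM.false
  have hbounded : ∀ s ≤ R, BoundedOff (fun i => e.symm (c i)) (u ∘ e) s
      (supAbs u (ball (0 : E2) s \ ⋃ i, closedBall (c i) 3)) := fun s hs z hz hzc => by
    refine abs_le_supAbs (hb.mono (image_mono (sdiff_subset_sdiff_left (ball_subset_ball hs)))) ?_
    exact ⟨by simpa using hz, by simpa [← hdist] using hzc⟩
  refine h ι _ R r N _ _ _ hv hR hr hrR hN (hbounded r (by linarith)) (hbounded R le_rfl) hM ?_
  have hne : ((fun z => |u z|) '' (ball (0 : E2) (R - R / 64) \ ⋃ i, closedBall (c i) 3)).Nonempty :=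
    ⟨_, mem_image_of_mem _ ⟨mem_ball_self (by linarith), h0⟩⟩
  obtain ⟨_, ⟨x, ⟨hx1, hx2⟩, rfl⟩, hx⟩ := exists_lt_of_lt_csSup hne (hsup.trans_lt' (half_lt_self
    (mul_pos (Real.exp_pos (-N)) hM)))
  refine ⟨e.symm x, by simpa using hx1, fun i => ?_, ?_⟩
  · simp only [mem_iUnion, mem_closedBall, not_exists, not_le] at hx2
    rw [e.symm.dist_map]
    exact hx2 i
  · rw [Function.comp_apply, e.apply_symm_apply]
    exact hx.le
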